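/- arXiv:2106.11831 — 11 statements merged into one kernel-verified Lean document; each statement's English description precedes it below -/
import Mathlib

section
/- As the real variable x tends to infinity, 2x·sin(π/(2x))·(1 − cos(δ₀(x)/2)) − π⁹/(8x⁸) = O(1/x¹⁰); that is, the gap between the perimeter upper bound 2x·sin(π/(2x)) and the perimeter 2x·sin(π/(2x))·cos(δ₀(x)/2) of the polygon D_x equals π⁹/(8x⁸) + O(1/x¹⁰). -/
open Real Filter Asymptotics

/-- `δ₀(x) = arctan(tan(2π/x)·tan(π/x)) − arcsin(sin(2π/x)·sin(π/x) / √(4·sin(π/x)² + cos(4π/x)))`. -/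
noncomputable def δ₀ (x : ℝ) : ℝ :=
  Real.arctan (Real.tan (2 * π / x) * Real.tan (π / x)) -
    Real.arcsin (Real.sin (2 * π / x) * Real.sin (π / x) /
      Real.sqrt (4 * Real.sin (π / x) ^ 2 + Real.cos (4 * π / x)))

open Topology

theorem sin_sub_self_isBigO : (fun y : ℝ => sin y - y) =O[𝓝 0] (fun y => y ^ 3) := by
  refine IsBigO.of_bound 1 ?_
  filter_upwards [Metric.ball_mem_nhds (0:ℝ) one_pos] with y hy
  have hy : |y| ≤ 1 := by simpa using (Metric.mem_ball.1 hy).le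
  have h := Real.sin_bound hy
  rw [norm_eq_abs, norm_eq_abs, abs_pow]
  have h3 : |y ^ 3 / 6| = |y| ^ 3 / 6 := by rw [abs_div, abs_pow]; norm_num
  have h4 : |y| ^ 5 ≤ |y| ^ 3 := pow_le_pow_of_le_one (abs_nonneg y) hy (by norm_num)
  have h5 : |sin y - y| ≤ |sin y - (y - y ^ 3 / 6)| + |y ^ 3 / 6| := by
    have := abs_sub (sin y - (y - y ^ 3 / 6)) (y ^ 3 / 6)
    rwa [show sin y - (y - y ^ 3 / 6) - y ^ 3 / 6 = sin y - y by ring] at this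
  have : 0 ≤ |y| ^ 3 := by positivity
  linarith

theorem one_sub_cos_isBigO : (fun y : ℝ => 1 - cos y - y ^ 2 / 2) =O[𝓝 0] (fun y => y ^ 4) := by
  refine IsBigO.of_bound (5 / 96) ?_
  filter_upwards [Metric.ball_mem_nhds (0:ℝ) one_pos] with y hy
  have hy : |y| ≤ 1 := by simpa using (Metric.mem_ball.1 hy).le
  have h := Real.cos_bound hy
  rw [norm_eq_abs, norm_eq_abs, abs_pow, ← abs_neg]
  convert h using 1
  · congr 1; ring
  · ring

theorem arcsin_sub_self_isBigO : (fun y : ℝ => arcsin y - y) =O[𝓝 0] (fun y => y ^ 3) := by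
  have hd : arcsin =O[𝓝 0] (fun y : ℝ => y) := by
    simpa using (hasDerivAt_arcsin (x := 0) (by norm_num) (by norm_num)).isBigO_sub
  have ht : Tendsto arcsin (𝓝 0) (𝓝 0) := by
    simpa using continuous_arcsin.tendsto 0
  have h := ((sin_sub_self_isBigO.comp_tendsto ht).trans (hd.pow 3)).neg_left
  refine h.congr' ?_ .rfl
  filter_upwards [Metric.ball_mem_nhds (0:ℝ) one_pos] with y hy
  have hy := abs_lt.1 (by simpa using (Metric.mem_ball.1 hy) : |y| < 1)
  simp [sin_arcsin hy.1.le hy.2.le]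

theorem arctan_sub_self_isBigO : (fun y : ℝ => arctan y - y) =O[𝓝 0] (fun y => y ^ 3) := by
  have hd : arctan =O[𝓝 0] (fun y : ℝ => y) := by
    simpa using (hasDerivAt_arctan 0).isBigO_sub
  have ht : Tendsto arctan (𝓝 0) (𝓝 0) := by
    simpa using continuous_arctan.tendsto 0
  have hs := (sin_sub_self_isBigO.comp_tendsto ht).trans (hd.pow 3)
  have hc' : (fun y : ℝ => cos y - 1) =O[𝓝 0] (fun y => y ^ 2) := by
    refine IsBigO.of_bound 1 (.of_forall fun y => ?_)
    have h1 := one_sub_sq_div_two_le_cos (x := y)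
    have h2 := cos_le_one y
    have := sq_nonneg y
    rw [norm_eq_abs, norm_of_nonneg (by positivity), abs_le]
    constructor <;> linarith
  have hc := (hc'.comp_tendsto ht).trans (hd.pow 2)
  have hm := ((isBigO_refl (fun y : ℝ => y) (𝓝 0)).mul hc).congr_right
    (g₂ := fun y => y ^ 3) fun y => by ring
  refine (hm.sub hs).congr_left fun y => ?_
  have : y * cos (arctan y) = sin (arctan y) := by
    conv_lhs => rw [← tan_arctan y]
    simpa using tan_mul_cos (cos_arctan_pos y).ne'
  simp only [Function.comp_apply]
  linarith

/-- The value of `δ₀ x` as a function of `q = sin (π / x) ^ 2`. -/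
noncomputable def gapAngle (q : ℝ) : ℝ :=
  arctan (2 * q / (1 - 2 * q)) - arcsin (2 * q * √(1 - q) / √(1 - 4 * q + 8 * q ^ 2))

theorem rationalized_difference {q : ℝ} (hq : |q| < 1 / 4) :
    2 * q / (1 - 2 * q) - 2 * q * √(1 - q) / √(1 - 4 * q + 8 * q ^ 2) =
      q ^ 2 * (2 * (1 + 4 * q ^ 2) / ((1 - 2 * q) * √(1 - 4 * q + 8 * q ^ 2) *
        (√(1 - 4 * q + 8 * q ^ 2) + (1 - 2 * q) * √(1 - q)))) := by
  obtain ⟨h1, h2⟩ := abs_lt.1 hq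
  have hS : 0 < 1 - 4 * q + 8 * q ^ 2 := by nlinarith [sq_nonneg (4 * q - 1)]
  have hm : 0 < 1 - 2 * q := by linarith
  have hr : 0 < √(1 - q) := sqrt_pos.2 (by linarith)
  have hD : 0 < √(1 - 4 * q + 8 * q ^ 2) := sqrt_pos.2 hS
  have hr2 := sq_sqrt (show 0 ≤ 1 - q by linarith)
  have hD2 := sq_sqrt hS.le
  set r := √(1 - q)
  set D := √(1 - 4 * q + 8 * q ^ 2)
  have hs : 0 < D + (1 - 2 * q) * r := by positivity
  rw [div_sub_div _ _ hm.ne' hD.ne', ← mul_div_assoc, div_eq_div_iff (by positivity) (by positivity)]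
  linear_combination (2 * q * ((1 - 2 * q) * D)) * hD2 -
    (2 * q * ((1 - 2 * q) * D)) * (1 - 2 * q) ^ 2 * hr2

theorem gapAngle_sub_sq_isBigO :
    (fun q : ℝ => gapAngle q - q ^ 2) =O[𝓝 0] (fun q => q ^ 3) := by
  have hdA : DifferentiableAt ℝ (fun q : ℝ => 2 * q / (1 - 2 * q)) 0 := by
    fun_prop (disch := norm_num)
  have hdB : DifferentiableAt ℝ
      (fun q : ℝ => 2 * q * √(1 - q) / √(1 - 4 * q + 8 * q ^ 2)) 0 := by
    fun_prop (disch := norm_num)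
  have hdh : DifferentiableAt ℝ
      (fun q : ℝ => 2 * (1 + 4 * q ^ 2) / ((1 - 2 * q) * √(1 - 4 * q + 8 * q ^ 2) *
        (√(1 - 4 * q + 8 * q ^ 2) + (1 - 2 * q) * √(1 - q)))) 0 := by
    fun_prop (disch := norm_num)
  have hA := hdA.isBigO_sub
  have hB := hdB.isBigO_sub
  have hh := hdh.isBigO_sub
  have htA := hdA.continuousAt.tendsto
  have htB := hdB.continuousAt.tendsto
  norm_num at hA hB hh htA htB
  have h1 := (arctan_sub_self_isBigO.comp_tendsto htA).trans (hA.pow 3)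
  have h2 := (arcsin_sub_self_isBigO.comp_tendsto htB).trans (hB.pow 3)
  have h3 := ((isBigO_refl (fun q : ℝ => q ^ 2) (𝓝 0)).mul hh).congr_right
    (g₂ := fun q => q ^ 3) fun q => by ring
  refine ((h1.sub h2).add h3).congr' ?_ .rfl
  filter_upwards [Metric.ball_mem_nhds (0 : ℝ) (show (0 : ℝ) < 1 / 4 by norm_num)] with q hq
  have h := rationalized_difference (by simpa using hq : |q| < 1 / 4)
  simp only [Function.comp_apply, gapAngle]
  linear_combination -h

theorem eventually_δ₀_eq_gapAngle :
    ∀ᶠ t in 𝓝 (0 : ℝ), δ₀ (π / t) = gapAngle (sin t ^ 2) := by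
  filter_upwards [Metric.ball_mem_nhds (0 : ℝ) one_pos] with t ht
  have ht := abs_lt.1 (by simpa using ht : |t| < 1)
  have hc : 0 < cos t := cos_pos_of_mem_Ioo ⟨by linarith [pi_gt_three], by linarith [pi_gt_three]⟩
  have hs : √(1 - sin t ^ 2) = cos t := by
    rw [← cos_sq', sqrt_sq hc.le]
  have h1 : π / (π / t) = t := div_div_cancel₀ pi_ne_zero
  have h2 : 2 * π / (π / t) = 2 * t := by rw [mul_div_assoc, h1]
  have h4 : 4 * π / (π / t) = 2 * (2 * t) := by rw [mul_div_assoc, h1]; ring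
  have hc2 : cos (2 * t) = 1 - 2 * sin t ^ 2 := by rw [cos_two_mul, cos_sq']; ring
  rw [δ₀, gapAngle, h1, h2, h4, hs, cos_two_mul (2 * t), tan_eq_sin_div_cos, tan_eq_sin_div_cos,
    hc2, sin_two_mul]
  congr 2
  · field_simp
  · ring_nf

theorem gapAngle_sin_sq_isBigO :
    (fun t : ℝ => gapAngle (sin t ^ 2) - t ^ 4) =O[𝓝 0] (fun t => t ^ 6) := by
  have hd : sin =O[𝓝 0] (fun t : ℝ => t) := by simpa using (hasDerivAt_sin 0).isBigO_sub
  have ht : Tendsto (fun t : ℝ => sin t ^ 2) (𝓝 0) (𝓝 0) := by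
    exact (continuous_sin.pow 2).tendsto' 0 0 (by simp)
  have h1 := (gapAngle_sub_sq_isBigO.comp_tendsto ht).trans ((hd.pow 2).pow 3)
  have hp : (fun t : ℝ => (sin t + t) * (sin t ^ 2 + t ^ 2)) =O[𝓝 0] (fun t => t * t ^ 2) :=
    (hd.add (isBigO_refl _ _)).mul ((hd.pow 2).add (isBigO_refl _ _))
  have h2 := sin_sub_self_isBigO.mul hp
  refine ((h1.congr_right (g₂ := fun t => t ^ 6) fun t => by ring).add
    (h2.congr_right (g₂ := fun t => t ^ 6) fun t => by ring)).congr_left fun t => ?_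
  simp only [Function.comp_apply]
  ring

theorem one_sub_cos_half_gapAngle_isBigO :
    (fun t : ℝ => 1 - cos (gapAngle (sin t ^ 2) / 2) - t ^ 8 / 8) =O[𝓝 0] (fun t => t ^ 10) := by
  have hG := gapAngle_sin_sq_isBigO
  have hpow {m n : ℕ} (h : n ≤ m) : (fun t : ℝ => t ^ m) =O[𝓝 0] (fun t => t ^ n) :=
    .of_bound 1 <| by
      filter_upwards [Metric.ball_mem_nhds (0 : ℝ) one_pos] with t ht
      rw [norm_pow, norm_pow, one_mul]
      exact pow_le_pow_of_le_one (norm_nonneg t) (by simpa using (Metric.mem_ball.1 ht).le) h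
  have hG4 : (fun t : ℝ => gapAngle (sin t ^ 2)) =O[𝓝 0] (fun t => t ^ 4) :=
    ((hG.trans (hpow (by norm_num : 4 ≤ 6))).add (isBigO_refl _ _)).congr_left fun t => by ring
  have hG2 : (fun t : ℝ => gapAngle (sin t ^ 2) / 2) =O[𝓝 0] (fun t => t ^ 4) :=
    (hG4.const_mul_left (1 / 2)).congr_left fun t => by ring
  have ht : Tendsto (fun t : ℝ => gapAngle (sin t ^ 2) / 2) (𝓝 0) (𝓝 0) :=
    hG2.trans_tendsto <| by simpa using (continuous_pow 4).tendsto (0 : ℝ)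
  have h1 := (one_sub_cos_isBigO.comp_tendsto ht).trans (hG2.pow 4)
  have h1 := (h1.congr_right (g₂ := fun t => t ^ 16) fun t => by ring).trans
    (hpow (by norm_num : 10 ≤ 16))
  have h2 := (hG.mul (hG4.add (isBigO_refl _ _))).const_mul_left (1 / 8)
  refine (h1.add (h2.congr_right (g₂ := fun t => t ^ 10) fun t => by ring)).congr_left fun t => ?_
  simp only [Function.comp_apply]
  ring

theorem perimeter_gap_Dn_isBigO :
    (fun x : ℝ => 2 * x * Real.sin (π / (2 * x)) * (1 - Real.cos (δ₀ x / 2))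
        - π ^ 9 / (8 * x ^ 8))
      =O[atTop] (fun x : ℝ => 1 / x ^ 10) := by
  have ht : Tendsto (fun x : ℝ => π / x) atTop (𝓝 0) := tendsto_const_nhds.div_atTop tendsto_id
  have ht2 : Tendsto (fun x : ℝ => π / (2 * x)) atTop (𝓝 0) :=
    tendsto_const_nhds.div_atTop (tendsto_id.const_mul_atTop two_pos)
  have hinv (c : ℝ) (n : ℕ) : (fun x : ℝ => c / x ^ n) =O[atTop] (fun x => 1 / x ^ n) :=
    (isBigO_const_mul_self c _ _).congr_left fun x => by ring
  have h1 : (fun x : ℝ => 1 - cos (δ₀ x / 2) - π ^ 8 / (8 * x ^ 8)) =O[atTop]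
      (fun x => 1 / x ^ 10) := by
    have h := (one_sub_cos_half_gapAngle_isBigO.comp_tendsto ht).trans
      ((hinv (π ^ 10) 10).congr_left fun x => (div_pow π x 10).symm)
    refine h.congr' ?_ .rfl
    filter_upwards [ht.eventually eventually_δ₀_eq_gapAngle] with x hx
    rw [div_div_cancel₀ pi_ne_zero] at hx
    simp only [Function.comp_apply, hx]
    ring
  have h2 : (fun x : ℝ => 2 * x * sin (π / (2 * x)) - π) =O[atTop] (fun x => 1 / x ^ 2) := by
    have h := (isBigO_refl (fun x : ℝ => 2 * x) atTop).mul (sin_sub_self_isBigO.comp_tendsto ht2)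
    refine (h.congr' ?_ ?_).trans (hinv (π ^ 3 / 4) 2)
    all_goals
      filter_upwards [eventually_ne_atTop 0] with x hx
      simp only [Function.comp_apply]
      field_simp
    norm_num
  have hb : (fun x : ℝ => 2 * x * sin (π / (2 * x))) =O[atTop] (fun _ => (1 : ℝ)) := by
    refine IsBigO.of_bound π ?_
    filter_upwards [eventually_gt_atTop 0] with x hx
    have h := abs_sin_le_abs (x := π / (2 * x))
    rw [abs_of_pos (show 0 < π / (2 * x) by positivity), le_div_iff₀ (by positivity)] at h
    rw [norm_mul, norm_of_nonneg (by positivity), norm_eq_abs]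
    simpa [mul_comm] using h
  have h3 := h2.mul (hinv (π ^ 8 / 8) 8)
  refine (((hb.mul h1).congr_right fun x => one_mul _).add
    (h3.congr_right fun x => by ring)).congr_left fun x => ?_
  ring
end

section
/- As the real variable x tends to infinity, 2x·sin(π/(2x))·(1 − cos(δ₀(x)/2)) − π⁹/(8x⁸) − 25π¹¹/(64x¹⁰) = O(1/x¹²). -/
open Real Filter Asymptotics

open Topology

/-- Continuous functions of bounded quantities are bounded. -/
lemma Continuous.comp_isBigO_one {α E : Type*} [NormedAddCommGroup E] [ProperSpace E]
    {l : Filter α} {f : E → ℝ} (hf : Continuous f) {φ : α → E}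
    (hφ : φ =O[l] fun _ => (1 : ℝ)) : (fun x => f (φ x)) =O[l] fun _ => (1 : ℝ) := by
  obtain ⟨C, hC⟩ := hφ.bound
  obtain ⟨M, hM⟩ := (isCompact_closedBall (0 : E) C).exists_bound_of_continuousOn hf.continuousOn
  refine IsBigO.of_bound M ?_
  filter_upwards [hC] with x hx
  simpa using hM (φ x) (by simpa using hx)

lemma Asymptotics.IsBigO.exists_bounded_mul {α : Type*} {l : Filter α} {f g : α → ℝ}
    (h : f =O[l] g) :
    ∃ φ : α → ℝ, φ =O[l] (fun _ => (1 : ℝ)) ∧ ∀ᶠ x in l, f x = φ x * g x := by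
  obtain ⟨φ, hφ, heq⟩ := isBigO_iff_exists_eq_mul.1 h
  exact ⟨φ, (isBigO_one_iff ℝ).2 hφ, heq⟩

lemma Asymptotics.IsBigO.of_bounded_mul {α : Type*} {l : Filter α} {f g φ : α → ℝ}
    (hφ : φ =O[l] fun _ => (1 : ℝ)) (h : ∀ᶠ x in l, f x = φ x * g x) : f =O[l] g :=
  isBigO_iff_exists_eq_mul.2 ⟨φ, (isBigO_one_iff ℝ).1 hφ, h⟩

lemma isBigO_sin_sub_cubic :
    (fun t : ℝ => sin t - (t - t ^ 3 / 6)) =O[𝓝 0] fun t => t ^ 5 := by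
  refine IsBigO.of_bound (1 / 100) ?_
  filter_upwards [Metric.closedBall_mem_nhds (0 : ℝ) one_pos] with t ht
  have := Real.sin_bound (x := t) (by simpa using ht)
  rw [norm_eq_abs, norm_eq_abs, abs_pow]
  linarith

lemma isBigO_cos_sub_quadratic :
    (fun t : ℝ => cos t - (1 - t ^ 2 / 2)) =O[𝓝 0] fun t => t ^ 4 := by
  refine IsBigO.of_bound (5 / 96) ?_
  filter_upwards [Metric.closedBall_mem_nhds (0 : ℝ) one_pos] with t ht
  have := Real.cos_bound (x := t) (by simpa using ht)
  rw [norm_eq_abs, norm_eq_abs, abs_pow]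
  linarith

lemma abs_arctan_sub_self_le_sq {z : ℝ} (hz : 0 ≤ z) : |arctan z - z| ≤ z ^ 2 := by
  have h0 : 0 ≤ arctan z := arctan_nonneg.2 hz
  have h1 : arctan z ≤ z := by
    simpa [tan_arctan] using le_tan h0 (arctan_lt_pi_div_two z)
  have h2 : z / √(1 + z ^ 2) ≤ arctan z := by
    simpa [sin_arctan] using sin_le h0
  have h3 : √(1 + z ^ 2) ≤ 1 + z := by
    rw [sqrt_le_left (by linarith)]; nlinarith
  have h4 : z - z ^ 2 ≤ z / √(1 + z ^ 2) := by
    rw [le_div_iff₀ (by positivity)]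
    have : 1 ≤ √(1 + z ^ 2) := one_le_sqrt.2 (by nlinarith)
    nlinarith [mul_nonneg hz (sub_nonneg.2 h3), mul_nonneg (sq_nonneg z) (sub_nonneg.2 this)]
  rw [abs_le]
  constructor <;> nlinarith

/-- The ratio of the tangents of the two angles in `δ₀ x`, as a function of `s = sin (π / x) ^ 2`. -/
noncomputable def tanRatio (s : ℝ) : ℝ :=
  √((1 - s) * (1 - 2 * s) ^ 2 / ((1 - 2 * s) ^ 2 + 4 * s ^ 3))

lemma tanRatio_nonneg (s : ℝ) : 0 ≤ tanRatio s := sqrt_nonneg _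

lemma tanRatio_le_one {s : ℝ} (hs : 0 < s) : tanRatio s ≤ 1 := by
  refine sqrt_le_one.2 (div_le_one_of_le₀ ?_ (by positivity))
  nlinarith [mul_nonneg hs.le (sq_nonneg (1 - 2 * s)), pow_pos hs 3]

lemma isBigO_tanRatio_sub :
    (fun s => tanRatio s - (1 - s / 2 - s ^ 2 / 8)) =O[𝓝[>] 0] fun s => s ^ 3 := by
  refine IsBigO.of_bound 10 ?_
  filter_upwards [Ioo_mem_nhdsGT (show (0 : ℝ) < 1 / 100 by norm_num)] with s ⟨hs, hs1⟩
  set D := (1 - 2 * s) ^ 2 + 4 * s ^ 3 with hD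
  have hs3 := pow_pos hs 3
  have hD0 : 9 / 10 ≤ D := by nlinarith
  have hD1 : D ≤ 1 := by nlinarith
  have hc := tanRatio_nonneg s
  have hsq : tanRatio s ^ 2 = (1 - s) * (1 - 2 * s) ^ 2 / D :=
    sq_sqrt (div_nonneg (mul_nonneg (by linarith) (sq_nonneg _)) (by linarith))
  set p := 1 - s / 2 - s ^ 2 / 8 with hp
  have hp0 : 9 / 10 ≤ p := by nlinarith
  have key : (tanRatio s - p) * ((tanRatio s + p) * D) =
      -(s ^ 3 * (4 * (1 - s) + (1 / 8 + s / 64) * D)) := by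
    have : (tanRatio s - p) * ((tanRatio s + p) * D) = tanRatio s ^ 2 * D - p ^ 2 * D := by ring
    rw [this, hsq, div_mul_cancel₀ _ (by linarith)]
    rw [hp, hD]; ring
  have habs := congrArg abs key
  have hpos : 1 / 2 ≤ (tanRatio s + p) * D := by nlinarith
  have hQ : 0 ≤ 4 * (1 - s) + (1 / 8 + s / 64) * D := by nlinarith [mul_pos hs (by linarith : 0 < D)]
  have hQ' : 4 * (1 - s) + (1 / 8 + s / 64) * D ≤ 5 := by nlinarith
  rw [abs_mul, abs_neg, abs_of_nonneg (a := (_ + _) * D) (by linarith),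
    abs_of_nonneg (mul_nonneg hs3.le hQ)] at habs
  rw [norm_eq_abs, norm_eq_abs, abs_of_pos hs3]
  nlinarith [abs_nonneg (tanRatio s - p), mul_le_mul_of_nonneg_left hQ' hs3.le,
    mul_le_mul_of_nonneg_left hpos (abs_nonneg (tanRatio s - p))]

/-- The tangent of `δ₀ x`, as a function of `s = sin (π / x) ^ 2`. -/
noncomputable def tanGap (s : ℝ) : ℝ :=
  2 * s * (1 - tanRatio s) * (1 - 2 * s) / ((1 - 2 * s) ^ 2 + 4 * s ^ 2 * tanRatio s)

lemma isBigO_id_one : (fun t : ℝ => t) =O[𝓝[>] 0] fun _ => (1 : ℝ) :=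
  Tendsto.isBigO_one ℝ (c := (0 : ℝ)) (tendsto_id.mono_left nhdsWithin_le_nhds)

lemma isBigO_tanGap_sub :
    (fun s => tanGap s - (s ^ 2 + 9 / 4 * s ^ 3)) =O[𝓝[>] 0] fun s => s ^ 4 := by
  obtain ⟨e, he, hce⟩ := isBigO_tanRatio_sub.exists_bounded_mul
  have hk : (fun s => ((1 - 2 * s) ^ 2 + 4 * s ^ 2 * tanRatio s)⁻¹) =O[𝓝[>] 0]
      fun _ => (1 : ℝ) := by
    refine IsBigO.of_bound 2 ?_
    filter_upwards [Ioo_mem_nhdsGT (show (0 : ℝ) < 1 / 100 by norm_num)] with s ⟨hs, hs1⟩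
    have h : 1 / 2 ≤ (1 - 2 * s) ^ 2 + 4 * s ^ 2 * tanRatio s := by
      nlinarith [mul_nonneg (sq_nonneg s) (tanRatio_nonneg s)]
    rw [norm_inv, norm_eq_abs, abs_of_pos (by linarith), norm_one, mul_one]
    exact inv_le_of_inv_le₀ (by norm_num) (by linarith)
  refine IsBigO.of_bounded_mul ((show Continuous fun q : ℝ × ℝ × ℝ =>
    (-(1 / 2) - 2 * q.2.1 * (1 - 2 * q.1) - 4 * (1 - q.1 / 2 - q.1 ^ 2 / 8 + q.2.1 * q.1 ^ 3)
      - 4 + 9 - 9 * q.1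
      - 9 * q.1 * (1 - q.1 / 2 - q.1 ^ 2 / 8 + q.2.1 * q.1 ^ 3)) * q.2.2
    by fun_prop).comp_isBigO_one (isBigO_id_one.prod_left (he.prod_left hk))) ?_
  filter_upwards [hce, Ioo_mem_nhdsGT (show (0 : ℝ) < 1 / 100 by norm_num)] with s hc ⟨hs, hs1⟩
  have hD : (1 - 2 * s) ^ 2 + 4 * s ^ 2 * tanRatio s ≠ 0 := by
    nlinarith [mul_nonneg (sq_nonneg s) (tanRatio_nonneg s)]
  have hc' : tanRatio s = 1 - s / 2 - s ^ 2 / 8 + e s * s ^ 3 := by linarith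
  have hinv := mul_inv_cancel₀ hD
  rw [tanGap, div_eq_mul_inv]
  generalize ((1 - 2 * s) ^ 2 + 4 * s ^ 2 * tanRatio s)⁻¹ = k at hinv ⊢
  rw [hc'] at hinv ⊢
  linear_combination (s ^ 2 + 9 / 4 * s ^ 3) * hinv

lemma isBigO_arctan_tanGap_sub :
    (fun s => arctan (tanGap s) - (s ^ 2 + 9 / 4 * s ^ 3)) =O[𝓝[>] 0] fun s => s ^ 4 := by
  have hsq : (fun s => tanGap s) =O[𝓝[>] 0] fun s : ℝ => s ^ 2 := by
    obtain ⟨b, hb, hzb⟩ := isBigO_tanGap_sub.exists_bounded_mul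
    refine IsBigO.of_bounded_mul ((show Continuous fun q : ℝ × ℝ =>
      1 + 9 / 4 * q.1 + q.2 * q.1 ^ 2 by fun_prop).comp_isBigO_one
        (isBigO_id_one.prod_left hb)) ?_
    filter_upwards [hzb] with s hs
    linear_combination hs
  have harctan : (fun s => arctan (tanGap s) - tanGap s) =O[𝓝[>] 0] fun s : ℝ => s ^ 4 := by
    have h4 : (fun s => tanGap s ^ 2) =O[𝓝[>] 0] fun s : ℝ => s ^ 4 := by
      simpa [← pow_mul] using hsq.pow 2
    refine IsBigO.trans (IsBigO.of_bound 1 ?_) h4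
    filter_upwards [Ioo_mem_nhdsGT (show (0 : ℝ) < 1 / 100 by norm_num)] with s ⟨hs, hs1⟩
    have hz : 0 ≤ tanGap s := by
      have := tanRatio_nonneg s
      exact div_nonneg (mul_nonneg (mul_nonneg (by linarith)
        (sub_nonneg.2 (tanRatio_le_one hs))) (by linarith)) (by positivity)
    simpa using abs_arctan_sub_self_le_sq hz
  exact (harctan.add isBigO_tanGap_sub).congr_left fun s => by ring

/-- The angle `δ₀ x` in terms of `t = π / x`. -/
lemma arctan_sub_arcsin_eq_arctan_tanGap {t : ℝ} (ht : 0 < t) (ht1 : t < 1 / 10) :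
    arctan (tan (2 * t) * tan t) -
      arcsin (sin (2 * t) * sin t / √(4 * sin t ^ 2 + cos (4 * t))) =
      arctan (tanGap (sin t ^ 2)) := by
  have hsin : 0 < sin t := sin_pos_of_pos_of_lt_pi ht (by linarith [pi_gt_three])
  have hcos : 0 < cos t := cos_pos_of_mem_Ioo ⟨by linarith [pi_gt_three], by linarith [pi_gt_three]⟩
  have hsc := sin_sq_add_cos_sq t
  have hs1 : sin t ^ 2 < 1 / 100 := by nlinarith [sin_lt ht]
  have hs0 : 0 < sin t ^ 2 := by positivity
  have hsin2 : sin (2 * t) = 2 * sin t * cos t := sin_two_mul t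
  have hcos2 : cos (2 * t) = 1 - 2 * sin t ^ 2 := by rw [cos_two_mul]; linarith
  have hcos4 : cos (4 * t) = 1 - 8 * sin t ^ 2 + 8 * (sin t ^ 2) ^ 2 := by
    rw [show 4 * t = 2 * (2 * t) by ring, cos_two_mul, hcos2]; ring
  have hcsq : cos t ^ 2 = 1 - sin t ^ 2 := by linarith
  have hA : tan (2 * t) * tan t = 2 * sin t ^ 2 / (1 - 2 * sin t ^ 2) := by
    rw [tan_eq_sin_div_cos, tan_eq_sin_div_cos, hsin2, hcos2]
    field_simp
  set s := sin t ^ 2 with hs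
  have hu : sin (2 * t) * sin t = 2 * s * cos t := by rw [hsin2, hs]; ring
  have hD : 4 * s + cos (4 * t) = 1 - 4 * s + 8 * s ^ 2 := by rw [hcos4]; ring
  have hDpos : 0 < 1 - 4 * s + 8 * s ^ 2 := by nlinarith
  have hEpos : 0 < (1 - 2 * s) ^ 2 + 4 * s ^ 3 := by
    have := pow_pos hs0 3
    nlinarith
  have hL : 0 < 1 - 2 * s := by linarith
  have hsq : (2 * s * cos t / √(1 - 4 * s + 8 * s ^ 2)) ^ 2 =
      4 * s ^ 2 * (1 - s) / (1 - 4 * s + 8 * s ^ 2) := by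
    rw [div_pow, sq_sqrt hDpos.le, mul_pow, hcsq]; ring
  have h1sub : 1 - 4 * s ^ 2 * (1 - s) / (1 - 4 * s + 8 * s ^ 2) =
      ((1 - 2 * s) ^ 2 + 4 * s ^ 3) / (1 - 4 * s + 8 * s ^ 2) := by
    rw [eq_div_iff hDpos.ne', sub_mul, div_mul_cancel₀ _ hDpos.ne']; ring
  have hmem : 2 * s * cos t / √(1 - 4 * s + 8 * s ^ 2) ∈ Set.Ioo (-1 : ℝ) 1 := by
    rw [Set.mem_Ioo, ← abs_lt, ← sq_lt_one_iff_abs_lt_one, hsq, ← sub_pos, h1sub]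
    positivity
  have hB : 2 * s * cos t / √(1 - 4 * s + 8 * s ^ 2) /
      √(1 - (2 * s * cos t / √(1 - 4 * s + 8 * s ^ 2)) ^ 2) =
      2 * s * tanRatio s / (1 - 2 * s) := by
    rw [hsq, h1sub, sqrt_div hEpos.le, tanRatio, sqrt_div (by nlinarith),
      sqrt_mul (by linarith), sqrt_sq hL.le, ← hcsq, sqrt_sq hcos.le]
    have hd := sqrt_pos.2 hDpos
    have he := sqrt_pos.2 hEpos
    generalize √(1 - 4 * s + 8 * s ^ 2) = d at hd ⊢
    generalize √((1 - 2 * s) ^ 2 + 4 * s ^ 3) = e at he ⊢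
    field_simp
  have hr := tanRatio_nonneg s
  rw [hA, hu, hD, arcsin_eq_arctan hmem, hB, sub_eq_add_neg, ← arctan_neg, arctan_add]
  · congr 1
    have : 0 < (1 - 2 * s) ^ 2 + 4 * s ^ 2 * tanRatio s := by positivity
    have h2 : 1 - 2 * s / (1 - 2 * s) * -(2 * s * tanRatio s / (1 - 2 * s)) =
        ((1 - 2 * s) ^ 2 + 4 * s ^ 2 * tanRatio s) / (1 - 2 * s) ^ 2 := by
      field_simp; ring
    rw [h2, tanGap]
    field_simp
    ring
  · have : 0 ≤ 2 * s / (1 - 2 * s) * (2 * s * tanRatio s / (1 - 2 * s)) := by positivity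
    linarith

lemma tendsto_sin_sq_nhdsGT : Tendsto (fun t => sin t ^ 2) (𝓝[>] 0) (𝓝[>] 0) := by
  refine tendsto_nhdsWithin_iff.2 ⟨?_, ?_⟩
  · exact ((show Continuous fun t => sin t ^ 2 by fun_prop).tendsto' 0 0 (by simp)).mono_left
      nhdsWithin_le_nhds
  · filter_upwards [Ioo_mem_nhdsGT pi_pos] with t ⟨h0, h1⟩
    exact pow_pos (sin_pos_of_pos_of_lt_pi h0 h1) 2

lemma isBigO_sin_sq_sub :
    (fun t => sin t ^ 2 - (t ^ 2 - t ^ 4 / 3)) =O[𝓝[>] 0] fun t => t ^ 6 := by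
  obtain ⟨a, ha, hsa⟩ := (isBigO_sin_sub_cubic.mono nhdsWithin_le_nhds :
    _ =O[𝓝[>] (0 : ℝ)] _).exists_bounded_mul
  refine IsBigO.of_bounded_mul ((show Continuous fun q : ℝ × ℝ =>
    1 / 36 + 2 * q.2 - q.2 * q.1 ^ 2 / 3 + q.2 ^ 2 * q.1 ^ 4 by fun_prop).comp_isBigO_one
      (isBigO_id_one.prod_left ha)) ?_
  filter_upwards [hsa] with t ht
  rw [show sin t = t - t ^ 3 / 6 + a t * t ^ 5 by linarith]
  ring

lemma isBigO_arctan_tanGap_sin_sq_sub :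
    (fun t => arctan (tanGap (sin t ^ 2)) - (t ^ 4 + 19 / 12 * t ^ 6)) =O[𝓝[>] 0]
      fun t => t ^ 8 := by
  obtain ⟨b, hb, hgb⟩ := (isBigO_arctan_tanGap_sub.comp_tendsto
    tendsto_sin_sq_nhdsGT).exists_bounded_mul
  obtain ⟨m, hm, hsm⟩ := isBigO_sin_sq_sub.exists_bounded_mul
  refine IsBigO.of_bounded_mul ((show Continuous fun q : ℝ × ℝ × ℝ =>
    2 * q.2.1 + (-(1 / 3) + q.1 ^ 2 * q.2.1) ^ 2 + 9 / 4 *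
      (3 * q.2.1 + 3 * (-(1 / 3) + q.1 ^ 2 * q.2.1) ^ 2
        + q.1 ^ 2 * (-(1 / 3) + q.1 ^ 2 * q.2.1) ^ 3) * q.1 ^ 2 - 9 / 4
      + (1 - q.1 ^ 2 / 3 + q.1 ^ 4 * q.2.1) ^ 4 * q.2.2
    by fun_prop).comp_isBigO_one (isBigO_id_one.prod_left (hm.prod_left hb))) ?_
  filter_upwards [hgb, hsm] with t hg hs
  simp only [Function.comp_apply] at hg
  have hs' : sin t ^ 2 = t ^ 2 - t ^ 4 / 3 + m t * t ^ 6 := by linarith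
  rw [show arctan (tanGap (sin t ^ 2)) = (sin t ^ 2) ^ 2 + 9 / 4 * (sin t ^ 2) ^ 3 +
    b t * (sin t ^ 2) ^ 4 by linarith, hs']
  ring

lemma isBigO_one_sub_cos_half_sub {d : ℝ → ℝ}
    (hd : (fun t => d t - (t ^ 4 + 19 / 12 * t ^ 6)) =O[𝓝[>] 0] fun t => t ^ 8) :
    (fun t => 1 - cos (d t / 2) - (t ^ 8 / 8 + 19 / 48 * t ^ 10)) =O[𝓝[>] 0]
      fun t => t ^ 12 := by
  obtain ⟨m, hm, hdm⟩ := hd.exists_bounded_mul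
  have hd4 : d =O[𝓝[>] 0] fun t => t ^ 4 := by
    refine IsBigO.of_bounded_mul ((show Continuous fun q : ℝ × ℝ =>
      1 + 19 / 12 * q.1 ^ 2 + q.2 * q.1 ^ 4 by fun_prop).comp_isBigO_one
        (isBigO_id_one.prod_left hm)) ?_
    filter_upwards [hdm] with t ht
    linear_combination ht
  have hlim : Tendsto (fun t => d t / 2) (𝓝[>] 0) (𝓝 0) := by
    have h4 : Tendsto (fun t : ℝ => t ^ 4) (𝓝[>] 0) (𝓝 0) :=
      ((continuous_pow 4).tendsto' 0 0 (by simp)).mono_left nhdsWithin_le_nhds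
    simpa using (hd4.trans_tendsto h4).div_const 2
  obtain ⟨r, hr, hcr⟩ := (isBigO_cos_sub_quadratic.comp_tendsto hlim).exists_bounded_mul
  refine IsBigO.of_bounded_mul ((show Continuous fun q : ℝ × ℝ × ℝ =>
    (2 * q.2.1 + (19 / 12 + q.1 ^ 2 * q.2.1) ^ 2) / 8
      - q.2.2 * q.1 ^ 4 * (1 + 19 / 12 * q.1 ^ 2 + q.1 ^ 4 * q.2.1) ^ 4 / 16
    by fun_prop).comp_isBigO_one (isBigO_id_one.prod_left (hm.prod_left hr))) ?_
  filter_upwards [hdm, hcr] with t ht hc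
  simp only [Function.comp_apply] at hc
  rw [show cos (d t / 2) = 1 - (d t / 2) ^ 2 / 2 + r t * (d t / 2) ^ 4 by linarith,
    show d t = t ^ 4 + 19 / 12 * t ^ 6 + m t * t ^ 8 by linarith]
  ring

lemma isBigO_perimeter_gap_sub :
    (fun t => 2 * (π / t) * sin (t / 2) * (1 - cos (arctan (tanGap (sin t ^ 2)) / 2))
        - π * t ^ 8 / 8 - 25 * π * t ^ 10 / 64) =O[𝓝[>] 0] fun t => t ^ 12 := by
  obtain ⟨p, hp, hcp⟩ :=
    (isBigO_one_sub_cos_half_sub isBigO_arctan_tanGap_sin_sq_sub).exists_bounded_mul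
  have hhalf : Tendsto (fun t : ℝ => t / 2) (𝓝[>] 0) (𝓝 0) :=
    ((show Continuous fun t : ℝ => t / 2 by fun_prop).tendsto' 0 0 (by simp)).mono_left
      nhdsWithin_le_nhds
  obtain ⟨a, ha, hsa⟩ := (isBigO_sin_sub_cubic.comp_tendsto hhalf).exists_bounded_mul
  refine IsBigO.of_bounded_mul ((show Continuous fun q : ℝ × ℝ × ℝ =>
    π * (q.2.1 / 16 * (1 / 8 + 19 / 48 * q.1 ^ 2 + q.1 ^ 4 * q.2.2)
      + (1 - q.1 ^ 2 / 24) * q.2.2 - 19 / 1152)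
    by fun_prop).comp_isBigO_one (isBigO_id_one.prod_left (ha.prod_left hp))) ?_
  filter_upwards [hsa, hcp, self_mem_nhdsWithin] with t hs hc ht
  simp only [Function.comp_apply] at hs
  have ht0 : t ≠ 0 := (Set.mem_Ioi.1 ht).ne'
  rw [show sin (t / 2) = t / 2 - (t / 2) ^ 3 / 6 + a t * (t / 2) ^ 5 by linarith,
    show 1 - cos (arctan (tanGap (sin t ^ 2)) / 2) =
      t ^ 8 / 8 + 19 / 48 * t ^ 10 + p t * t ^ 12 by linarith]
  field_simp
  ring

theorem perimeter_gap_Dn_isBigO' :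
    (fun x : ℝ => 2 * x * Real.sin (π / (2 * x)) * (1 - Real.cos (δ₀ x / 2))
        - π ^ 9 / (8 * x ^ 8) - 25 * π ^ 11 / (64 * x ^ 10))
      =O[atTop] (fun x : ℝ => 1 / x ^ 12) := by
  have hlim : Tendsto (fun x : ℝ => π / x) atTop (𝓝[>] 0) := by
    refine tendsto_nhdsWithin_iff.2 ⟨tendsto_const_nhds.div_atTop tendsto_id, ?_⟩
    filter_upwards [eventually_gt_atTop 0] with x hx
    exact div_pos pi_pos hx
  have hscale : (fun x : ℝ => (π / x) ^ 12) =O[atTop] fun x => 1 / x ^ 12 :=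
    (isBigO_const_mul_self (π ^ 12) (fun x : ℝ => 1 / x ^ 12) atTop).congr_left
      fun x => by ring
  refine ((isBigO_perimeter_gap_sub.comp_tendsto hlim).trans hscale).congr' ?_ .rfl
  filter_upwards [eventually_gt_atTop 0,
    hlim.eventually (Ioo_mem_nhdsGT (show (0 : ℝ) < 1 / 10 by norm_num))] with x hx ⟨h0, h1⟩
  have hδ : δ₀ x = arctan (tanGap (sin (π / x) ^ 2)) := by
    rw [← arctan_sub_arcsin_eq_arctan_tanGap h0 h1, δ₀, mul_div_assoc 2, mul_div_assoc 4]
  simp only [Function.comp_apply]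
  rw [hδ, show π / (π / x) = x by field_simp, show π / x / 2 = π / (2 * x) by field_simp]
  field_simp
end

section
/- As the real variable x tends to infinity, δ₀(x) − π⁴/x⁴ − 19π⁶/(12x⁶) = O(1/x⁸). -/
open Real Filter Asymptotics

theorem arctan_le_self_of_nonneg {x : ℝ} (hx : 0 ≤ x) : arctan x ≤ x := by
  simpa using le_tan (arctan_nonneg.2 hx) (arctan_lt_pi_div_two x)

theorem sub_cube_le_arctan {x : ℝ} (hx : 0 ≤ x) : x - x ^ 3 ≤ arctan x := by
  have h1 : √(1 + x ^ 2) ≤ 1 + x ^ 2 := by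
    rw [sqrt_le_left (by positivity)]
    nlinarith [sq_nonneg x, sq_nonneg (x ^ 2)]
  calc x - x ^ 3 ≤ x / (1 + x ^ 2) := by
        rw [le_div_iff₀ (by positivity)]
        nlinarith [pow_nonneg hx 5]
    _ ≤ x / √(1 + x ^ 2) := by gcongr
    _ = sin (arctan x) := (sin_arctan x).symm
    _ ≤ arctan x := sin_le (arctan_nonneg.2 hx)

/-- The cubic expansion of the positive root `R` of `R² ((1 - 2s)² + 4s³) = 4s² (1 - s)`. -/
theorem abs_sub_cubic_le {s R : ℝ} (hs : 0 < s) (hs' : s ≤ 1 / 100) (hR : 0 < R)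
    (h : R ^ 2 * ((1 - 2 * s) ^ 2 + 4 * s ^ 3) = 4 * s ^ 2 * (1 - s)) :
    |R - (2 * s + 3 * s ^ 2 + 23 / 4 * s ^ 3)| ≤ 100 * s ^ 4 := by
  have hE : 0 < (1 - 2 * s) ^ 2 + 4 * s ^ 3 := by
    have : 0 < 1 - 2 * s := by linarith
    positivity
  have hp (n : ℕ) : s ^ (n + 1) ≤ s ^ n / 100 := by
    rw [pow_succ]; nlinarith [pow_pos hs n]
  rw [abs_le]
  constructor
  · have : 2 * s + 3 * s ^ 2 + 23 / 4 * s ^ 3 - 100 * s ^ 4 ≤ R := by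
      refine (le_abs_self _).trans (abs_le_of_sq_le_sq ?_ hR.le)
      refine le_of_mul_le_mul_right ?_ hE
      rw [h]
      ring_nf
      linarith [hp 5, hp 6, hp 7, hp 8, hp 9, hp 10, pow_pos hs 5, pow_pos hs 11]
    linarith
  · have : R ≤ 2 * s + 3 * s ^ 2 + 23 / 4 * s ^ 3 + 100 * s ^ 4 := by
      refine (le_abs_self _).trans (abs_le_of_sq_le_sq ?_ (by positivity))
      refine le_of_mul_le_mul_right ?_ hE
      rw [h]
      ring_nf
      linarith [hp 5, hp 6, hp 7, hp 8, hp 9, hp 10, pow_pos hs 5, pow_pos hs 11]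
    linarith

theorem abs_arctan_sub_arctan_sub_le {s P R : ℝ} (hs : 0 < s) (hs' : s ≤ 1 / 100)
    (hP : P * (1 - 2 * s) = 2 * s) (hR : 0 < R)
    (h : R ^ 2 * ((1 - 2 * s) ^ 2 + 4 * s ^ 3) = 4 * s ^ 2 * (1 - s)) :
    |arctan P - arctan R - s ^ 2 - 9 / 4 * s ^ 3| ≤ 150 * s ^ 4 := by
  have hp (n : ℕ) : s ^ (n + 1) ≤ s ^ n / 100 := by
    rw [pow_succ]; nlinarith [pow_pos hs n]
  obtain ⟨hR1, hR2⟩ := abs_le.1 (abs_sub_cubic_le hs hs' hR h)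
  have hP1 : 2 * s + 4 * s ^ 2 + 8 * s ^ 3 ≤ P := by
    by_contra! hc
    nlinarith [mul_lt_mul_of_pos_right hc (show 0 < 1 - 2 * s by linarith), pow_pos hs 4]
  have hP2 : P ≤ 2 * s + 4 * s ^ 2 + 8 * s ^ 3 + 20 * s ^ 4 := by
    by_contra! hc
    nlinarith [mul_lt_mul_of_pos_right hc (show 0 < 1 - 2 * s by linarith), pow_pos hs 4, hp 4]
  have h2 := pow_pos hs 2
  have hP0 : 0 < P := by nlinarith [pow_pos hs 3]
  have hP3 : P ≤ 3 * s := by linarith [hp 1, hp 2, hp 3, pow_one s]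
  have hR3 : R ≤ 3 * s := by linarith [hp 1, hp 2, hp 3, pow_one s]
  have hPR : P * R ≤ 9 * s ^ 2 := by nlinarith
  have hPR0 : 0 < P * R := mul_pos hP0 hR
  have hd0 : 0 ≤ P - R := by linarith [hp 2, hp 3, pow_pos hs 3]
  have hd : P - R ≤ 2 * s ^ 2 := by linarith [hp 2, hp 3, pow_pos hs 3]
  have harc : arctan P - arctan R = arctan ((P - R) / (1 + P * R)) := by
    have := arctan_add (x := P) (y := -R) (by linarith)
    rw [arctan_neg] at this
    rw [sub_eq_add_neg, this]
    congr 1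
    ring
  have hx0 : 0 ≤ (P - R) / (1 + P * R) := by positivity
  have hx1 : (P - R) / (1 + P * R) ≤ P - R := div_le_self hd0 (by linarith)
  have hx2 : (P - R) - 18 * s ^ 4 ≤ (P - R) / (1 + P * R) := by
    have h3 : (P - R) * (P * R) ≤ 18 * s ^ 4 := by
      calc (P - R) * (P * R) ≤ (2 * s ^ 2) * (9 * s ^ 2) := by gcongr
        _ = 18 * s ^ 4 := by ring
    rw [le_div_iff₀ (by linarith)]
    nlinarith [mul_pos (pow_pos hs 4) hPR0]
  have hx3 : ((P - R) / (1 + P * R)) ^ 3 ≤ s ^ 4 := by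
    calc ((P - R) / (1 + P * R)) ^ 3 ≤ (2 * s ^ 2) ^ 3 := by gcongr; linarith
      _ = 8 * s ^ 6 := by ring
      _ ≤ s ^ 4 := by linarith [hp 4, hp 5, pow_pos hs 4]
  have ha := arctan_le_self_of_nonneg hx0
  have hb := sub_cube_le_arctan hx0
  have h4 := pow_pos hs 4
  rw [harc, abs_le]
  constructor <;> linarith

theorem abs_sin_sq_expansion_le {t : ℝ} (ht0 : 0 ≤ t) (ht : t ≤ 1 / 10) :
    |(sin t ^ 2) ^ 2 + 9 / 4 * (sin t ^ 2) ^ 3 - t ^ 4 - 19 / 12 * t ^ 6| ≤ 50 * t ^ 8 := by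
  have habs : |t| = t := abs_of_nonneg ht0
  have hsin := sin_bound (x := t) (by rw [habs]; linarith)
  rw [habs] at hsin
  have hw : t ^ 2 ≤ 1 / 100 := by nlinarith
  obtain ⟨m, hm, hsm⟩ : ∃ m : ℝ, |m| ≤ 1 ∧ sin t ^ 2 = t ^ 2 - t ^ 4 / 3 + t ^ 6 * m := by
    rcases ht0.eq_or_lt with rfl | hpos
    · exact ⟨0, by simp, by simp⟩
    obtain ⟨e, he, hse⟩ : ∃ e : ℝ, |e| ≤ 1 / 100 ∧ sin t = t - t ^ 3 / 6 + t ^ 5 * e := by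
      refine ⟨(sin t - (t - t ^ 3 / 6)) / t ^ 5, ?_, by field_simp; ring⟩
      rw [abs_div, abs_of_pos (pow_pos hpos 5), div_le_iff₀ (pow_pos hpos 5)]
      linarith
    refine ⟨1 / 36 + 2 * e - t ^ 2 * e / 3 + t ^ 4 * e ^ 2, ?_, by rw [hse]; ring⟩
    obtain ⟨he1, he2⟩ := abs_le.1 he
    have h2 := sq_nonneg t
    have h3 : |t ^ 2 * e| ≤ 1 / 100 * (1 / 100) := by
      rw [abs_mul, abs_of_nonneg h2]; gcongr
    have h4 : |t ^ 2 * e| ^ 2 ≤ (1 / 100 * (1 / 100)) ^ 2 := by gcongr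
    rw [sq_abs, mul_pow, ← pow_mul] at h4
    have h5 : 0 ≤ t ^ 4 * e ^ 2 := by positivity
    obtain ⟨h6, h7⟩ := abs_le.1 h3
    norm_num at h4
    rw [abs_le]
    constructor <;> linarith
  obtain ⟨w, hwt⟩ : ∃ w, w = t ^ 2 := ⟨_, rfl⟩
  have hw0 : 0 ≤ w := hwt ▸ sq_nonneg t
  rw [← hwt] at hw
  have e4 : t ^ 4 = w ^ 2 := by rw [hwt]; ring
  have e6 : t ^ 6 = w ^ 3 := by rw [hwt]; ring
  have e8 : t ^ 8 = w ^ 4 := by rw [hwt]; ring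
  rw [hsm, e4, e6, e8, ← hwt]
  obtain ⟨k, hk⟩ : ∃ k, k = -1 / 3 + w * m := ⟨_, rfl⟩
  have hwm : |w * m| ≤ 1 / 100 * 1 := by rw [abs_mul, abs_of_nonneg hw0]; gcongr
  have hk1 : |k| ≤ 1 := by
    rw [abs_le] at hwm ⊢; constructor <;> linarith [hwm.1, hwm.2]
  have hk2 : |w * k| ≤ 1 * 1 := by rw [abs_mul, abs_of_nonneg hw0]; gcongr; linarith
  have key : (w - w ^ 2 / 3 + w ^ 3 * m) ^ 2 + 9 / 4 * (w - w ^ 2 / 3 + w ^ 3 * m) ^ 3 - w ^ 2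
      - 19 / 12 * w ^ 3 =
      w ^ 4 * (2 * m + k * k + 9 / 4 * (k * (3 + 3 * (w * k) + (w * k) * (w * k)))) := by
    rw [hk]; ring
  rw [key, abs_mul, abs_of_nonneg (pow_nonneg hw0 4), mul_comm]
  gcongr
  have h1 : |k * k| ≤ 1 * 1 := by rw [abs_mul]; gcongr
  have h2 : |(w * k) * (w * k)| ≤ (1 * 1) * (1 * 1) := by rw [abs_mul]; gcongr
  have h3 : |k * (3 + 3 * (w * k) + (w * k) * (w * k))| ≤ 1 * 7 := by
    rw [abs_mul]
    gcongr
    rw [abs_le] at *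
    constructor <;> linarith [hk2.1, hk2.2, h2.1, h2.2]
  rw [abs_le] at *
  constructor <;> linarith [h1.1, h1.2, h3.1, h3.2, hm.1, hm.2]

theorem abs_arctan_tan_mul_sub_arcsin_sub_le {t : ℝ} (ht0 : 0 < t) (ht : t ≤ 1 / 10) :
    |arctan (tan (2 * t) * tan t) -
        arcsin (sin (2 * t) * sin t / √(4 * sin t ^ 2 + cos (4 * t))) -
      t ^ 4 - 19 / 12 * t ^ 6| ≤ 200 * t ^ 8 := by
  have hsin0 : 0 < sin t := sin_pos_of_pos_of_lt_pi ht0 (by linarith [pi_gt_three])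
  have hcos0 : 0 < cos t := cos_pos_of_mem_Ioo ⟨by linarith [pi_gt_three], by linarith [pi_gt_three]⟩
  have hsint : sin t ≤ t := sin_le ht0.le
  have hst : sin t ^ 2 ≤ t ^ 2 := by gcongr
  obtain ⟨s, hs⟩ : ∃ s, s = sin t ^ 2 := ⟨_, rfl⟩
  have hs0 : 0 < s := hs ▸ pow_pos hsin0 2
  have hs1 : s ≤ 1 / 100 := by nlinarith
  have hc : cos t ^ 2 = 1 - s := by rw [hs, cos_sq']
  have hc2 : cos (2 * t) = 1 - 2 * s := by rw [cos_two_mul, hc]; ring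
  have hc4 : cos (4 * t) = 1 - 8 * s + 8 * s ^ 2 := by
    rw [show 4 * t = 2 * (2 * t) by ring, cos_two_mul, hc2]; ring
  have hnum : sin (2 * t) * sin t = 2 * s * cos t := by rw [sin_two_mul, hs]; ring
  have hD : 4 * sin t ^ 2 + cos (4 * t) = 1 - 4 * s + 8 * s ^ 2 := by rw [hc4, ← hs]; ring
  have hD0 : 0 < 1 - 4 * s + 8 * s ^ 2 := by nlinarith
  have hE0 : 0 < (1 - 2 * s) ^ 2 + 4 * s ^ 3 := by
    have : 0 < 1 - 2 * s := by linarith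
    positivity
  have hP : tan (2 * t) * tan t * (1 - 2 * s) = 2 * s := by
    rw [tan_eq_sin_div_cos, tan_eq_sin_div_cos, div_mul_div_comm, hnum, hc2]
    have : 1 - 2 * s ≠ 0 := by linarith
    field_simp
  rw [hD, hnum]
  obtain ⟨q, hq⟩ : ∃ q, q = 2 * s * cos t / √(1 - 4 * s + 8 * s ^ 2) := ⟨_, rfl⟩
  have hq0 : 0 < q := by rw [hq]; positivity
  have hq2 : q ^ 2 = 4 * s ^ 2 * (1 - s) / (1 - 4 * s + 8 * s ^ 2) := by
    rw [hq, div_pow, sq_sqrt hD0.le, mul_pow, hc]; ring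
  have hq3 : 1 - q ^ 2 = ((1 - 2 * s) ^ 2 + 4 * s ^ 3) / (1 - 4 * s + 8 * s ^ 2) := by
    rw [hq2, eq_div_iff hD0.ne', sub_mul, div_mul_cancel₀ _ hD0.ne']; ring
  have hq4 : 0 < 1 - q ^ 2 := by rw [hq3]; positivity
  rw [← hq, arcsin_eq_arctan ⟨by linarith, by nlinarith⟩]
  have hR : (q / √(1 - q ^ 2)) ^ 2 * ((1 - 2 * s) ^ 2 + 4 * s ^ 3) = 4 * s ^ 2 * (1 - s) := by
    rw [div_pow, sq_sqrt hq4.le, hq3, hq2,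
      div_div_div_cancel_right₀ hD0.ne', div_mul_cancel₀ _ hE0.ne']
  have h1 := abs_arctan_sub_arctan_sub_le hs0 hs1 hP (by positivity) hR
  have h2 := abs_sin_sq_expansion_le ht0.le ht
  rw [← hs] at h2
  have h3 : s ^ 4 ≤ t ^ 8 := by
    calc s ^ 4 ≤ (t ^ 2) ^ 4 := by rw [hs]; gcongr
      _ = t ^ 8 := by ring
  rw [abs_le] at *
  constructor <;> linarith [h1.1, h1.2, h2.1, h2.2]

theorem delta0_asymptotics :
    (fun x : ℝ => δ₀ x - π ^ 4 / x ^ 4 - 19 * π ^ 6 / (12 * x ^ 6))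
      =O[atTop] (fun x : ℝ => 1 / x ^ 8) := by
  refine IsBigO.of_bound (200 * π ^ 8) ?_
  filter_upwards [eventually_ge_atTop (10 * π)] with x hx
  have hx0 : 0 < x := by linarith [pi_pos]
  have h := abs_arctan_tan_mul_sub_arcsin_sub_le (t := π / x) (by positivity)
    (by rw [div_le_iff₀ hx0]; linarith)
  rw [norm_eq_abs, norm_of_nonneg (by positivity), δ₀]
  convert h using 1
  · rw [div_pow, div_pow, mul_div_assoc 2 π x, mul_div_assoc 4 π x, ← div_mul_div_comm]
  · rw [div_pow]; ring
end

section
/- For every real number x ≥ 8, the number δ = δ₀(x) satisfies the equation sin(π/x)·cos(δ)/cos(2π/x) − cos(π/x)·sin(δ)/sin(2π/x) = sin(2π/x)/(2·cos(2π/x)). -/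
open Real Filter Asymptotics

theorem delta0_solves_equation (x : ℝ) (hx : 8 ≤ x) :
    Real.sin (π / x) * Real.cos (δ₀ x) / Real.cos (2 * π / x)
      - Real.cos (π / x) * Real.sin (δ₀ x) / Real.sin (2 * π / x)
      = Real.sin (2 * π / x) / (2 * Real.cos (2 * π / x)) := by
  have hpi := Real.pi_pos
  have ha0 : 0 < π / x := by positivity
  have ha8 : π / x ≤ π / 8 := div_le_div_of_nonneg_left hpi.le (by norm_num) hx
  have h2 : 2 * π / x = 2 * (π / x) := by ring
  have h4 : 4 * π / x = 2 * (2 * (π / x)) := by ring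
  unfold δ₀
  rw [h2, h4]
  generalize π / x = a at ha0 ha8
  have hs : 0 < sin a := sin_pos_of_pos_of_lt_pi ha0 (by linarith)
  have hc : 0 < cos a := cos_pos_of_mem_Ioo ⟨by linarith, by linarith⟩
  have hC : 0 < cos (2 * a) := cos_pos_of_mem_Ioo ⟨by linarith, by linarith⟩
  have hS : sin (2 * a) = 2 * sin a * cos a := sin_two_mul a
  have hcc : cos a ^ 2 = 1 - sin a ^ 2 := cos_sq' a
  have hCs : cos (2 * a) = 1 - 2 * sin a ^ 2 := by rw [cos_two_mul, hcc]; ring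
  have hD : 4 * sin a ^ 2 + cos (2 * (2 * a)) = cos (2 * a) ^ 2 + (2 * sin a ^ 2) ^ 2 := by
    rw [cos_two_mul (2 * a), hCs]; ring
  rw [hD]
  have hDpos : 0 < cos (2 * a) ^ 2 + (2 * sin a ^ 2) ^ 2 := by positivity
  set r := √(cos (2 * a) ^ 2 + (2 * sin a ^ 2) ^ 2) with hr
  have hr0 : 0 < r := Real.sqrt_pos.2 hDpos
  have hr2 : r ^ 2 = cos (2 * a) ^ 2 + (2 * sin a ^ 2) ^ 2 := Real.sq_sqrt hDpos.le
  have htan : tan (2 * a) * tan a = 2 * sin a ^ 2 / cos (2 * a) := by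
    rw [tan_eq_sin_div_cos, tan_eq_sin_div_cos, hS]
    field_simp
  have hsqrt : √(1 + (2 * sin a ^ 2 / cos (2 * a)) ^ 2) = r / cos (2 * a) := by
    rw [Real.sqrt_eq_iff_mul_self_eq_of_pos (by positivity)]
    field_simp
    linear_combination hr2
  have hq0 : 0 ≤ sin (2 * a) * sin a / r := by rw [hS]; positivity
  have hq1 : sin (2 * a) * sin a / r ≤ 1 := by
    rw [div_le_one hr0]
    refine Real.le_sqrt_of_sq_le ?_
    have : (sin (2 * a) * sin a) ^ 2 = (2 * sin a ^ 2) ^ 2 * cos a ^ 2 := by rw [hS]; ring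
    rw [this]
    nlinarith [mul_le_mul_of_nonneg_left (cos_sq_le_one a) (sq_nonneg (2 * sin a ^ 2)),
      sq_nonneg (cos (2 * a))]
  rw [htan, cos_sub, sin_sub, cos_arctan, sin_arctan, hsqrt,
    Real.sin_arcsin (by linarith) hq1]
  generalize cos (arcsin (sin (2 * a) * sin a / r)) = w
  rw [hS]
  field_simp
  linear_combination (-cos a) * hr2
end

section
/- For every real number x ≥ 16, one has 0 < δ₀(x) < π/x. -/
open Real Filter Asymptotics

theorem tan_two_mul_mul_tan {t : ℝ} (hc : cos t ≠ 0) :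
    tan (2 * t) * tan t = 2 * sin t ^ 2 / (1 - 2 * sin t ^ 2) := by
  rw [tan_eq_sin_div_cos, tan_eq_sin_div_cos, sin_two_mul, cos_two_mul', cos_sq', div_mul_div_comm,
    show 2 * sin t * cos t * sin t = 2 * sin t ^ 2 * cos t by ring,
    mul_div_mul_right _ _ hc]
  ring_nf

theorem four_mul_sin_sq_add_cos_four_mul (t : ℝ) :
    4 * sin t ^ 2 + cos (4 * t) = (1 - 2 * sin t ^ 2) ^ 2 + (2 * sin t ^ 2) ^ 2 := by
  rw [show 4 * t = 2 * (2 * t) by ring, cos_two_mul, cos_two_mul, cos_sq']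
  ring

theorem arctan_div_eq_arcsin {a b : ℝ} (hb : 0 < b) :
    arctan (a / b) = arcsin (a / √(b ^ 2 + a ^ 2)) := by
  rw [arctan_eq_arcsin, show b ^ 2 + a ^ 2 = b ^ 2 * (1 + (a / b) ^ 2) by field_simp,
    sqrt_mul (sq_nonneg b), sqrt_sq hb.le, div_div]

theorem arctan_le_self_of_nonneg_s7 {a : ℝ} (ha : 0 ≤ a) : arctan a ≤ a := by
  simpa only [tan_arctan] using le_tan (arctan_nonneg.2 ha) (arctan_lt_pi_div_two a)

theorem delta0_pos_lt (x : ℝ) (hx : 16 ≤ x) :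
    0 < δ₀ x ∧ δ₀ x < π / x := by
  have hx0 : 0 < x := by linarith
  rw [δ₀, mul_div_assoc 2, mul_div_assoc 4]
  have ht : 0 < π / x := div_pos pi_pos hx0
  have ht' : π / x < 1 / 5 := by
    rw [div_lt_iff₀ hx0]
    linarith [pi_lt_d2]
  generalize π / x = t at ht ht'
  have hpi : 3 < π := pi_gt_three
  have hs : 0 < sin t := sin_pos_of_pos_of_lt_pi ht (by linarith)
  have hst : sin t < t := sin_lt ht
  have hc : 0 < cos t := cos_pos_of_mem_Ioo ⟨by linarith, by linarith⟩
  have hc1 : cos t < 1 := by nlinarith [sin_sq_add_cos_sq t]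
  have hst2 : sin t ^ 2 < t / 5 := by nlinarith
  have hu : 0 < sin t ^ 2 := by positivity
  have hb : 0 < 1 - 2 * sin t ^ 2 := by linarith
  rw [tan_two_mul_mul_tan hc.ne', four_mul_sin_sq_add_cos_four_mul,
    show sin (2 * t) * sin t = 2 * sin t ^ 2 * cos t by rw [sin_two_mul]; ring]
  constructor
  · rw [sub_pos, arctan_div_eq_arcsin hb]
    have hr : 0 < √((1 - 2 * sin t ^ 2) ^ 2 + (2 * sin t ^ 2) ^ 2) := by positivity
    refine arcsin_lt_arcsin ?_ ?_ ?_
    · exact neg_one_lt_zero.le.trans (by positivity)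
    · gcongr ?_ / _
      exact mul_lt_of_lt_one_right (by positivity) hc1
    · rw [div_le_one hr]
      exact le_sqrt_of_sq_le (by nlinarith)
  · have harcsin : 0 ≤ arcsin (2 * sin t ^ 2 * cos t /
        √((1 - 2 * sin t ^ 2) ^ 2 + (2 * sin t ^ 2) ^ 2)) := arcsin_nonneg.2 (by positivity)
    have harctan := arctan_le_self_of_nonneg_s7 (div_nonneg (mul_nonneg zero_le_two hu.le) hb.le)
    have hlt : 2 * sin t ^ 2 / (1 - 2 * sin t ^ 2) < t := by
      rw [div_lt_iff₀ hb]
      nlinarith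
    linarith
end

section
/- For every integer s ≥ 4, n = 2^s, and every real number δ, the following finite sum identity holds: ∑_{j=1}^{n/8} (−1)^{j−1} [ sin((4j−3)π/n − (−1)^j δ) − sin((4j−1)π/n + (−1)^j δ) ] + ∑_{j=1}^{n/8−1} (−1)^{j−1} sin(4jπ/n) = (cos(2π/n) + sin(2π/n))/(2·cos(2π/n)) − sin(π/n)·cos δ / cos(2π/n) + cos(π/n)·sin δ / sin(2π/n). -/
open Real Finset

theorem two_mul_sin_mul_sum_cos_odd (y : ℝ) (m : ℕ) :
    2 * Real.sin y * ∑ j ∈ Finset.Icc 1 m, Real.cos ((2 * (j : ℝ) - 1) * y)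
      = Real.sin (2 * m * y) := by
  induction m with
  | zero => simp
  | succ k ih =>
    rw [Finset.sum_Icc_succ_top (by omega), mul_add, ih]
    push_cast
    rw [show 2 * (k : ℝ) * y = (2 * ((k : ℝ) + 1) - 1) * y - y by ring,
      show 2 * ((k : ℝ) + 1) * y = (2 * ((k : ℝ) + 1) - 1) * y + y by ring,
      Real.sin_sub, Real.sin_add]
    ring

theorem two_mul_cos_mul_sum_alternating_cos_odd (y : ℝ) (m : ℕ) :
    2 * Real.cos y *
        ∑ j ∈ Finset.Icc 1 m, (-1 : ℝ) ^ (j - 1) * Real.cos ((2 * (j : ℝ) - 1) * y)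
      = 1 - (-1 : ℝ) ^ m * Real.cos (2 * m * y) := by
  induction m with
  | zero => simp
  | succ k ih =>
    rw [Finset.sum_Icc_succ_top (by omega), mul_add, ih, Nat.add_sub_cancel]
    push_cast
    rw [show 2 * (k : ℝ) * y = (2 * ((k : ℝ) + 1) - 1) * y - y by ring,
      show 2 * ((k : ℝ) + 1) * y = (2 * ((k : ℝ) + 1) - 1) * y + y by ring,
      Real.cos_sub, Real.cos_add]
    ring

theorem two_mul_cos_mul_sum_alternating_sin_even (y : ℝ) (m : ℕ) :
    2 * Real.cos y * ∑ j ∈ Finset.Icc 1 m, (-1 : ℝ) ^ (j - 1) * Real.sin (2 * (j : ℝ) * y)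
      = Real.sin y - (-1 : ℝ) ^ m * Real.sin ((2 * m + 1) * y) := by
  induction m with
  | zero => simp
  | succ k ih =>
    rw [Finset.sum_Icc_succ_top (by omega), mul_add, ih, Nat.add_sub_cancel]
    push_cast
    rw [show (2 * (k : ℝ) + 1) * y = 2 * ((k : ℝ) + 1) * y - y by ring,
      show (2 * ((k : ℝ) + 1) + 1) * y = 2 * ((k : ℝ) + 1) * y + y by ring,
      Real.sin_sub, Real.sin_add]
    ring

theorem alternating_mul_sin_sub_sin (x δ : ℝ) {j : ℕ} (hj : 1 ≤ j) :
    (-1 : ℝ) ^ (j - 1) * (Real.sin ((4 * (j : ℝ) - 3) * x - (-1 : ℝ) ^ j * δ)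
        - Real.sin ((4 * (j : ℝ) - 1) * x + (-1 : ℝ) ^ j * δ))
      = -2 * Real.sin x * Real.cos δ *
            ((-1 : ℝ) ^ (j - 1) * Real.cos ((2 * (j : ℝ) - 1) * (2 * x)))
        + 2 * Real.cos x * Real.sin δ * Real.cos ((2 * (j : ℝ) - 1) * (2 * x)) := by
  obtain ⟨k, rfl⟩ := Nat.exists_eq_add_of_le' hj
  rw [Nat.add_sub_cancel]
  generalize hc : (2 * ((k + 1 : ℕ) : ℝ) - 1) * (2 * x) = c
  rw [show (4 * ((k + 1 : ℕ) : ℝ) - 3) * x = c - x by rw [← hc]; ring,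
    show (4 * ((k + 1 : ℕ) : ℝ) - 1) * x = c + x by rw [← hc]; ring]
  rcases neg_one_pow_eq_or ℝ k with h | h <;>
  · simp only [pow_succ, h, one_mul, neg_mul, mul_neg, mul_one, neg_neg, sub_neg_eq_add,
      ← sub_eq_add_neg, Real.sin_add, Real.sin_sub, Real.cos_add, Real.cos_sub]
    ring

theorem abscissa_sum_identity (s : ℕ) (hs : 4 ≤ s) (n : ℕ) (hn : n = 2 ^ s) (δ : ℝ) :
    (∑ j ∈ Finset.Icc 1 (n / 8), (-1 : ℝ) ^ (j - 1) *
        (Real.sin ((4 * (j : ℝ) - 3) * π / n - (-1 : ℝ) ^ j * δ)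
          - Real.sin ((4 * (j : ℝ) - 1) * π / n + (-1 : ℝ) ^ j * δ)))
      + ∑ j ∈ Finset.Icc 1 (n / 8 - 1), (-1 : ℝ) ^ (j - 1) * Real.sin (4 * (j : ℝ) * π / n)
    = (Real.cos (2 * π / n) + Real.sin (2 * π / n)) / (2 * Real.cos (2 * π / n))
      - Real.sin (π / n) * Real.cos δ / Real.cos (2 * π / n)
      + Real.cos (π / n) * Real.sin δ / Real.sin (2 * π / n) := by
  obtain ⟨k, hk, rfl⟩ : ∃ k : ℕ, 0 < k ∧ n = 16 * k := by
    obtain ⟨t, rfl⟩ := Nat.exists_eq_add_of_le hs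
    exact ⟨2 ^ t, by positivity, by rw [hn, pow_add]; norm_num⟩
  rw [show 16 * k / 8 = 2 * k by omega]
  have hk1 : (1 : ℝ) ≤ k := by exact_mod_cast hk
  set x : ℝ := π / (16 * k : ℕ) with hx
  have hkx : 16 * (k : ℝ) * x = π := by
    rw [hx]; push_cast; field_simp
  have hx0 : 0 < x := by rw [hx]; positivity
  have hx1 : 16 * x ≤ π := by nlinarith
  have hsin : Real.sin (2 * x) ≠ 0 :=
    (Real.sin_pos_of_pos_of_lt_pi (by linarith) (by linarith)).ne'
  have hcos : Real.cos (2 * x) ≠ 0 :=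
    (Real.cos_pos_of_mem_Ioo ⟨by linarith, by linarith⟩).ne'
  have hA := two_mul_sin_mul_sum_cos_odd (2 * x) (2 * k)
  have hB := two_mul_cos_mul_sum_alternating_cos_odd (2 * x) (2 * k)
  have hC := two_mul_cos_mul_sum_alternating_sin_even (2 * x) (2 * k - 1)
  have hquarter : 2 * ((2 * k : ℕ) : ℝ) * (2 * x) = π / 2 := by
    push_cast; linarith
  have hlast : (2 * ((2 * k - 1 : ℕ) : ℝ) + 1) * (2 * x) = π / 2 - 2 * x := by
    rw [Nat.cast_sub (by omega), ← hquarter]; push_cast; ring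
  rw [hquarter, Real.sin_pi_div_two] at hA
  rw [hquarter, Real.cos_pi_div_two, mul_zero, sub_zero] at hB
  rw [hlast, Real.sin_pi_div_two_sub, Odd.neg_one_pow ⟨k - 1, by omega⟩] at hC
  simp only [mul_div_assoc, ← hx]
  rw [Finset.sum_congr rfl fun j hj =>
      alternating_mul_sin_sub_sin x δ (Finset.mem_Icc.mp hj).1,
    Finset.sum_add_distrib, ← Finset.mul_sum, ← Finset.mul_sum,
    Finset.sum_congr rfl fun (j : ℕ) _ =>
      show (-1 : ℝ) ^ (j - 1) * Real.sin (4 * (j : ℝ) * x)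
        = (-1 : ℝ) ^ (j - 1) * Real.sin (2 * (j : ℝ) * (2 * x)) by
          rw [show 4 * (j : ℝ) * x = 2 * (j : ℝ) * (2 * x) by ring]]
  rw [mul_comm, ← eq_div_iff (by simpa using hsin)] at hA
  rw [mul_comm, ← eq_div_iff (by simpa using hcos)] at hB hC
  rw [hA, hB, hC]
  field_simp
  ring
end

section
/- For every integer s ≥ 4, n = 2^s, and every real number δ, the following finite sum identity holds: ∑_{j=1}^{n/8} (−1)^{j−1} [ cos((4j−3)π/n − (−1)^j δ) − cos((4j−1)π/n + (−1)^j δ) ] + ∑_{j=1}^{n/8−1} (−1)^{j−1} cos(4jπ/n) = (cos(2π/n) + sin(2π/n))/(2·cos(2π/n)) − sin(π/n)·cos δ / cos(2π/n) − cos(π/n)·sin δ / sin(2π/n). -/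
open Real Finset

lemma two_mul_sin_mul_sum_sin_odd (x : ℝ) (M : ℕ) :
    2 * sin x * ∑ j ∈ Icc 1 M, sin ((2 * (j : ℝ) - 1) * x) = 1 - cos (2 * M * x) := by
  induction M with
  | zero => simp
  | succ k ih =>
    rw [sum_Icc_succ_top (by omega), mul_add, ih]
    push_cast
    rw [show 2 * (k : ℝ) * x = (2 * ((k : ℝ) + 1) - 1) * x - x by ring,
      show 2 * ((k : ℝ) + 1) * x = (2 * ((k : ℝ) + 1) - 1) * x + x by ring, cos_sub, cos_add]
    ring

lemma two_mul_cos_mul_sum_alternating_sin_odd (x : ℝ) (M : ℕ) :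
    2 * cos x * ∑ j ∈ Icc 1 M, (-1 : ℝ) ^ j * sin ((2 * (j : ℝ) - 1) * x)
      = (-1) ^ M * sin (2 * M * x) := by
  induction M with
  | zero => simp
  | succ k ih =>
    rw [sum_Icc_succ_top (by omega), mul_add, ih]
    push_cast
    rw [show 2 * (k : ℝ) * x = (2 * ((k : ℝ) + 1) - 1) * x - x by ring,
      show 2 * ((k : ℝ) + 1) * x = (2 * ((k : ℝ) + 1) - 1) * x + x by ring, sin_sub, sin_add]
    ring

lemma two_mul_cos_mul_sum_alternating_cos_even (x : ℝ) (K : ℕ) :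
    2 * cos x * ∑ j ∈ Icc 1 K, (-1 : ℝ) ^ (j - 1) * cos (2 * (j : ℝ) * x)
      = cos x - (-1) ^ K * cos ((2 * K + 1) * x) := by
  induction K with
  | zero => simp
  | succ k ih =>
    rw [sum_Icc_succ_top (by omega), mul_add, ih, Nat.add_sub_cancel]
    push_cast
    rw [show (2 * (k : ℝ) + 1) * x = 2 * ((k : ℝ) + 1) * x - x by ring,
      show (2 * ((k : ℝ) + 1) + 1) * x = 2 * ((k : ℝ) + 1) * x + x by ring, cos_sub, cos_add]
    ring

lemma alternating_mul_cos_sub_cos (p δ : ℝ) {j : ℕ} (hj : 1 ≤ j) :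
    (-1 : ℝ) ^ (j - 1) * (cos ((4 * (j : ℝ) - 3) * p - (-1 : ℝ) ^ j * δ)
        - cos ((4 * (j : ℝ) - 1) * p + (-1 : ℝ) ^ j * δ))
      = -(2 * sin p * cos δ) * ((-1) ^ j * sin ((2 * (j : ℝ) - 1) * (2 * p)))
        - 2 * cos p * sin δ * sin ((2 * (j : ℝ) - 1) * (2 * p)) := by
  obtain ⟨k, rfl⟩ := Nat.exists_eq_add_of_le' hj
  rw [Nat.add_sub_cancel, pow_succ]
  set y : ℝ := (2 * ((k + 1 : ℕ) : ℝ) - 1) * (2 * p) with hy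
  rw [show (4 * ((k + 1 : ℕ) : ℝ) - 3) * p - (-1) ^ k * -1 * δ = y - (p - (-1) ^ k * δ) by
      rw [hy]; ring,
    show (4 * ((k + 1 : ℕ) : ℝ) - 1) * p + (-1) ^ k * -1 * δ = y + (p - (-1) ^ k * δ) by
      rw [hy]; ring, cos_sub, cos_add, sin_sub]
  rcases neg_one_pow_eq_or ℝ k with h | h <;> rw [h] <;> simp <;> ring

theorem ordinate_sum_identity (s : ℕ) (hs : 4 ≤ s) (n : ℕ) (hn : n = 2 ^ s) (δ : ℝ) :
    (∑ j ∈ Finset.Icc 1 (n / 8), (-1 : ℝ) ^ (j - 1) *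
        (Real.cos ((4 * (j : ℝ) - 3) * π / n - (-1 : ℝ) ^ j * δ)
          - Real.cos ((4 * (j : ℝ) - 1) * π / n + (-1 : ℝ) ^ j * δ)))
      + ∑ j ∈ Finset.Icc 1 (n / 8 - 1), (-1 : ℝ) ^ (j - 1) * Real.cos (4 * (j : ℝ) * π / n)
    = (Real.cos (2 * π / n) + Real.sin (2 * π / n)) / (2 * Real.cos (2 * π / n))
      - Real.sin (π / n) * Real.cos δ / Real.cos (2 * π / n)
      - Real.cos (π / n) * Real.sin δ / Real.sin (2 * π / n) := by
  obtain ⟨t, rfl⟩ := Nat.exists_eq_add_of_le hs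
  obtain ⟨k, hk⟩ : ∃ k, 2 ^ t = k + 1 := Nat.exists_eq_succ_of_ne_zero (by positivity)
  have hnk : n = 8 * (2 * k + 2) := by rw [hn, pow_add, hk]; ring
  clear hn hs hk
  have hM : n / 8 = 2 * k + 2 := by omega
  have hn16 : (n : ℝ) = 16 * (k + 1) := by rw [hnk]; push_cast; ring
  have hn0 : (0 : ℝ) < n := by rw [hn16]; positivity
  have hp : 0 < π / n := by positivity
  have hnp : 16 * ((k : ℝ) + 1) * (π / n) = π := by rw [← hn16]; field_simp
  have hp16 : 16 * (π / n) ≤ π := by nlinarith [mul_nonneg (Nat.cast_nonneg (α := ℝ) k) hp.le]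
  rw [hM, show 2 * k + 2 - 1 = 2 * k + 1 by omega]
  simp only [mul_div_assoc]
  generalize π / (n : ℝ) = p at *
  have hs2 : 0 < sin (2 * p) := sin_pos_of_pos_of_lt_pi (by linarith) (by linarith)
  have hc2 : 0 < cos (2 * p) := cos_pos_of_mem_Ioo ⟨by linarith, by linarith⟩
  rw [sum_congr rfl fun j hj ↦ alternating_mul_cos_sub_cos p δ (mem_Icc.1 hj).1,
    sum_sub_distrib, ← mul_sum, ← mul_sum]
  have h1 := two_mul_sin_mul_sum_sin_odd (2 * p) (2 * k + 2)
  have h2 := two_mul_cos_mul_sum_alternating_sin_odd (2 * p) (2 * k + 2)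
  have h3 := two_mul_cos_mul_sum_alternating_cos_even (2 * p) (2 * k + 1)
  have hev : (-1 : ℝ) ^ (2 * k + 2) = 1 := Even.neg_one_pow ⟨k + 1, by ring⟩
  have hodd : (-1 : ℝ) ^ (2 * k + 1) = -1 := Odd.neg_one_pow ⟨k, rfl⟩
  have hang : 2 * ((2 * k + 2 : ℕ) : ℝ) * (2 * p) = π / 2 := by push_cast; linarith
  have hang' : (2 * ((2 * k + 1 : ℕ) : ℝ) + 1) * (2 * p) = π / 2 - 2 * p := by
    push_cast; linarith
  rw [hang, cos_pi_div_two, sub_zero] at h1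
  rw [hev, hang, sin_pi_div_two, mul_one] at h2
  rw [hodd, hang', cos_pi_div_two_sub] at h3
  have hcongr : ∀ j : ℕ, 2 * (j : ℝ) * (2 * p) = 4 * (j : ℝ) * p := fun j ↦ by ring
  simp only [hcongr] at h3
  rw [eq_div_of_mul_eq (by positivity) ((mul_comm _ _).trans h1),
    eq_div_of_mul_eq (by positivity) ((mul_comm _ _).trans h2),
    eq_div_of_mul_eq (by positivity) ((mul_comm _ _).trans h3)]
  field_simp
  ring
end

section
/- For every positive integer n divisible by 8 and every real number δ, ∑_{k=0}^{3n/8−1} 4·c_k·sin((π/n + (−1)^k δ)/2) = 2n·sin(π/(2n))·cos(δ/2), where c_k = 2 if k ≡ 1 (mod 3) and c_k = 1 otherwise. -/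
open Real Finset

/-- Each block of three consecutive terms carries equal total weight on both signs of `δ`. -/
theorem sum_range_three_mul_sin_alternating (a δ : ℝ) (m : ℕ) :
    ∑ k ∈ Finset.range (3 * m),
        4 * (if k % 3 = 1 then (2 : ℝ) else 1) * Real.sin ((a + (-1 : ℝ) ^ k * δ) / 2)
      = 16 * m * Real.sin (a / 2) * Real.cos (δ / 2) := by
  induction m with
  | zero => simp
  | succ m ih =>
    have h0 : 3 * m % 3 ≠ 1 := by lia
    have h1 : (3 * m + 1) % 3 = 1 := by lia
    have h2 : (3 * m + 2) % 3 ≠ 1 := by lia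
    rw [show 3 * (m + 1) = 3 * m + 1 + 1 + 1 by ring, sum_range_succ, sum_range_succ,
      sum_range_succ, ih, if_neg h0, if_pos h1, if_neg h2]
    have hadd : Real.sin ((a + δ) / 2) + Real.sin ((a - δ) / 2)
        = 2 * Real.sin (a / 2) * Real.cos (δ / 2) := by
      rw [add_div, sub_div, Real.sin_add, Real.sin_sub]
      ring
    simp only [pow_succ]
    push_cast
    rcases neg_one_pow_eq_or ℝ (3 * m) with h | h <;> rw [h] <;> norm_num <;>
      simp only [← sub_eq_add_neg] <;> linear_combination 8 * hadd

theorem perimeter_parametrization (n : ℕ) (hpos : 0 < n) (hdvd : 8 ∣ n) (δ : ℝ) :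
    ∑ k ∈ Finset.range (3 * n / 8),
        4 * (if k % 3 = 1 then (2 : ℝ) else 1) * Real.sin ((π / n + (-1 : ℝ) ^ k * δ) / 2)
      = 2 * n * Real.sin (π / (2 * n)) * Real.cos (δ / 2) := by
  obtain ⟨m, rfl⟩ := hdvd
  rw [show 3 * (8 * m) / 8 = 3 * m by lia, sum_range_three_mul_sin_alternating, div_div,
    mul_comm ((8 * m : ℕ) : ℝ) 2]
  push_cast
  ring
end

section
/- For every integer s ≥ 4 and n = 2^s, the value of the sum ∑_{j=1}^{n/8} (−1)^{j−1} [ sin((4j−3)π/n − (−1)^j δ) − sin((4j−1)π/n + (−1)^j δ) ] + ∑_{j=1}^{n/8−1} (−1)^{j−1} sin(4jπ/n) at δ = δ₀(n) equals 1/2. -/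
open Real Finset

theorem sum_cos_odd_multiples (t : ℝ) (m : ℕ) :
    2 * sin (2 * t) * ∑ j ∈ Finset.Icc 1 m, cos ((4 * (j : ℝ) - 2) * t)
      = sin (4 * (m : ℝ) * t) := by
  induction m with
  | zero => simp
  | succ k ih =>
    rw [Finset.sum_Icc_succ_top (by omega), mul_add, ih]
    have h1 : 4 * (k : ℝ) * t = (4 * ((k + 1 : ℕ) : ℝ) - 2) * t - 2 * t := by push_cast; ring
    have h2 : 4 * ((k + 1 : ℕ) : ℝ) * t = (4 * ((k + 1 : ℕ) : ℝ) - 2) * t + 2 * t := by ring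
    rw [h1, h2, sin_sub, sin_add]
    ring

theorem sum_alternating_cos_odd_multiples (t : ℝ) (m : ℕ) :
    2 * cos (2 * t) * ∑ j ∈ Finset.Icc 1 m, (-1 : ℝ) ^ j * cos ((4 * (j : ℝ) - 2) * t)
      = (-1) ^ m * cos (4 * (m : ℝ) * t) - 1 := by
  induction m with
  | zero => simp
  | succ k ih =>
    rw [Finset.sum_Icc_succ_top (by omega), mul_add, ih]
    have h1 : 4 * (k : ℝ) * t = (4 * ((k + 1 : ℕ) : ℝ) - 2) * t - 2 * t := by push_cast; ring
    have h2 : 4 * ((k + 1 : ℕ) : ℝ) * t = (4 * ((k + 1 : ℕ) : ℝ) - 2) * t + 2 * t := by ring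
    rw [h1, h2, cos_sub, cos_add, pow_succ]
    ring

theorem sum_alternating_sin_even_multiples (t : ℝ) (m : ℕ) :
    2 * cos (2 * t) * ∑ j ∈ Finset.Icc 1 m, (-1 : ℝ) ^ (j - 1) * sin (4 * (j : ℝ) * t)
      = sin (2 * t) - (-1) ^ m * sin ((4 * (m : ℝ) + 2) * t) := by
  induction m with
  | zero => simp
  | succ k ih =>
    rw [Finset.sum_Icc_succ_top (by omega), mul_add, ih]
    have h1 : (4 * (k : ℝ) + 2) * t = 4 * ((k + 1 : ℕ) : ℝ) * t - 2 * t := by push_cast; ring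
    have h2 : (4 * ((k + 1 : ℕ) : ℝ) + 2) * t = 4 * ((k + 1 : ℕ) : ℝ) * t + 2 * t := by ring
    rw [h1, h2, sin_sub, sin_add, pow_succ, Nat.add_sub_cancel]
    ring

/-- The trigonometric equation `sin δ - tan 2p tan p cos δ = - tan 2p sin p`, cleared of
denominators, is solved by `δ = δ₀ (π / p)`. -/
theorem sin_δ₀_mul_sub_cos_δ₀_mul {x : ℝ} (hx : 8 ≤ x) :
    sin (δ₀ x) * (cos (2 * (π / x)) * cos (π / x)) - cos (δ₀ x) * (sin (2 * (π / x)) * sin (π / x))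
      = -(sin (2 * (π / x)) * sin (π / x) * cos (π / x)) := by
  have hp0 : 0 < π / x := div_pos pi_pos (by linarith)
  have hp8 : π / x ≤ π / 8 := div_le_div_of_nonneg_left pi_pos.le (by norm_num) hx
  have hpi := pi_pos
  unfold δ₀
  rw [mul_div_assoc 2, mul_div_assoc 4]
  generalize π / x = p at *
  have hc1 : 0 < cos p := cos_pos_of_mem_Ioo ⟨by linarith, by linarith⟩
  have hc2 : 0 < cos (2 * p) := cos_pos_of_mem_Ioo ⟨by linarith, by linarith⟩
  have hs1 : 0 < sin p := sin_pos_of_pos_of_lt_pi hp0 (by linarith)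
  have hs2 : 0 < sin (2 * p) := sin_pos_of_pos_of_lt_pi (by linarith) (by linarith)
  have hs2c2 : sin (2 * p) ≤ cos (2 * p) := by
    rw [← cos_pi_div_two_sub]
    exact cos_le_cos_of_nonneg_of_le_pi (by linarith) (by linarith) (by linarith)
  have hRc : (4 * sin p ^ 2 + cos (4 * p)) * cos p ^ 2
      = (cos (2 * p) * cos p) ^ 2 + (sin (2 * p) * sin p) ^ 2 := by
    rw [show 4 * p = 2 * (2 * p) by ring, cos_two_mul' (2 * p)]
    have h := sin_two_mul p
    have h1 := sin_sq_add_cos_sq p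
    linear_combination (-(2 * sin p * cos p + sin (2 * p))) * h - sin (2 * p) ^ 2 * h1
  have hRpos : 0 < 4 * sin p ^ 2 + cos (4 * p) := by
    refine pos_of_mul_pos_left (b := cos p ^ 2) ?_ (by positivity)
    rw [hRc]; positivity
  generalize hR : 4 * sin p ^ 2 + cos (4 * p) = R at *
  have hD : √R ^ 2 = R := sq_sqrt hRpos.le
  have hDpos : 0 < √R := sqrt_pos.2 hRpos
  have hDc : cos (2 * p) * cos p ≤ √R * cos p := by
    refine (sq_le_sq₀ (by positivity) (by positivity)).1 ?_
    rw [mul_pow √R, hD, hRc]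
    nlinarith [sq_nonneg (sin (2 * p) * sin p)]
  have hDc2 : cos (2 * p) ≤ √R := le_of_mul_le_mul_right hDc hc1
  have hX : sin (2 * p) * sin p / √R ≤ 1 := by
    rw [div_le_one hDpos]
    nlinarith [sin_le_one p]
  have hX0 : 0 ≤ sin (2 * p) * sin p / √R := by positivity
  have hsqrt : √(1 + (tan (2 * p) * tan p) ^ 2) = √R / cos (2 * p) := by
    rw [← sqrt_sq (by positivity : 0 ≤ √R / cos (2 * p))]
    congr 1
    rw [tan_eq_sin_div_cos, tan_eq_sin_div_cos, div_pow, hD]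
    field_simp
    linear_combination -hRc
  rw [sin_sub, cos_sub, sin_arctan, cos_arctan, hsqrt, sin_arcsin (by linarith) hX,
    tan_eq_sin_div_cos, tan_eq_sin_div_cos]
  field_simp
  rw [hD]
  linear_combination hRc

theorem abscissa_at_delta0 (s : ℕ) (hs : 4 ≤ s) (n : ℕ) (hn : n = 2 ^ s) :
    (∑ j ∈ Finset.Icc 1 (n / 8), (-1 : ℝ) ^ (j - 1) *
        (Real.sin ((4 * (j : ℝ) - 3) * π / n - (-1 : ℝ) ^ j * δ₀ n)
          - Real.sin ((4 * (j : ℝ) - 1) * π / n + (-1 : ℝ) ^ j * δ₀ n)))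
      + ∑ j ∈ Finset.Icc 1 (n / 8 - 1), (-1 : ℝ) ^ (j - 1) * Real.sin (4 * (j : ℝ) * π / n)
    = 1 / 2 := by
  obtain ⟨k, rfl⟩ := Nat.exists_eq_add_of_le hs
  have hn16 : n = 16 * 2 ^ k := by rw [hn, pow_add]; norm_num
  have hk : 1 ≤ 2 ^ k := Nat.one_le_two_pow
  obtain ⟨m, hm, hnm, hmeven⟩ : ∃ m, n / 8 = m + 1 ∧ n = 8 * (m + 1) ∧ Odd m :=
    ⟨2 * 2 ^ k - 1, by omega, by omega, ⟨2 ^ k - 1, by omega⟩⟩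
  have hx : (8 : ℝ) ≤ n := by exact_mod_cast (by omega : 8 ≤ n)
  have key := sin_δ₀_mul_sub_cos_δ₀_mul hx
  have hp0 : 0 < π / n := div_pos pi_pos (by linarith)
  have hp8 : π / n ≤ π / 8 := div_le_div_of_nonneg_left pi_pos.le (by norm_num) hx
  have hpi := pi_pos
  have hright : 4 * ((m + 1 : ℕ) : ℝ) * (π / n) = π / 2 := by
    rw [hnm]; push_cast; field_simp; norm_num
  rw [hm, Nat.add_sub_cancel]
  simp only [mul_div_assoc]
  generalize δ₀ n = d at *
  generalize π / (n : ℝ) = p at *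
  have hc1 : 0 < cos p := cos_pos_of_mem_Ioo ⟨by linarith, by linarith⟩
  have hc2 : 0 < cos (2 * p) := cos_pos_of_mem_Ioo ⟨by linarith, by linarith⟩
  have hs2 : 0 < sin (2 * p) := sin_pos_of_pos_of_lt_pi (by linarith) (by linarith)
  have hterm : ∀ j ∈ Finset.Icc 1 (m + 1), (-1 : ℝ) ^ (j - 1) *
      (sin ((4 * (j : ℝ) - 3) * p - (-1 : ℝ) ^ j * d)
        - sin ((4 * (j : ℝ) - 1) * p + (-1 : ℝ) ^ j * d))
      = 2 * sin p * cos d * ((-1 : ℝ) ^ j * cos ((4 * (j : ℝ) - 2) * p))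
        + 2 * cos p * sin d * cos ((4 * (j : ℝ) - 2) * p) := by
    intro j hj
    obtain ⟨i, rfl⟩ := Nat.exists_eq_add_of_le' (Finset.mem_Icc.1 hj).1
    rw [Nat.add_sub_cancel, pow_succ]
    generalize ((i + 1 : ℕ) : ℝ) = y
    rw [show (4 * y - 3) * p = (4 * y - 2) * p - p by ring,
      show (4 * y - 1) * p = (4 * y - 2) * p + p by ring]
    rcases neg_one_pow_eq_or ℝ i with h | h <;> rw [h] <;>
      simp only [sin_add, sin_sub, cos_add, cos_sub, one_mul, neg_mul, neg_neg, mul_neg, sin_neg,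
        cos_neg] <;> ring
  rw [Finset.sum_congr rfl hterm, Finset.sum_add_distrib, ← Finset.mul_sum, ← Finset.mul_sum]
  have hA := sum_cos_odd_multiples p (m + 1)
  have hB := sum_alternating_cos_odd_multiples p (m + 1)
  have hC := sum_alternating_sin_even_multiples p m
  have hlast : (4 * (m : ℝ) + 2) * p = π / 2 - 2 * p := by
    rw [← hright]; push_cast; ring
  rw [hright, sin_pi_div_two] at hA
  rw [hright, cos_pi_div_two] at hB
  rw [hlast, sin_pi_div_two_sub, hmeven.neg_one_pow] at hC
  generalize (∑ j ∈ Finset.Icc 1 (m + 1), cos ((4 * (j : ℝ) - 2) * p)) = A at *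
  generalize (∑ j ∈ Finset.Icc 1 (m + 1), (-1 : ℝ) ^ j * cos ((4 * (j : ℝ) - 2) * p)) = B at *
  generalize (∑ j ∈ Finset.Icc 1 m, (-1 : ℝ) ^ (j - 1) * sin (4 * (j : ℝ) * p)) = C at *
  have hdouble := sin_two_mul p
  have hne : 2 * cos (2 * p) * sin (2 * p) ≠ 0 := by positivity
  apply mul_left_cancel₀ hne
  linear_combination 2 * sin p * cos d * sin (2 * p) * hB + 2 * cos p * sin d * cos (2 * p) * hA
    + sin (2 * p) * hC + 2 * key + sin (2 * p) * hdouble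
end

section
/- As the real variable x tends to infinity, 2x·sin(π/(2x))·(1 − cos(δ_B(x)/2)) − π⁷/(32x⁶) = O(1/x⁸); that is, the gap between the perimeter upper bound 2x·sin(π/(2x)) and the perimeter 2x·sin(π/(2x))·cos(π/(2x) − (1/2)·arcsin((1/2)·sin(2π/x))) of the polygon B_x equals π⁷/(32x⁶) + O(1/x⁸). -/
open Real Filter Asymptotics

/-- `δ_B(x) = π/x − arcsin((1/2)·sin(2π/x))`. -/
noncomputable def δB (x : ℝ) : ℝ :=
  π / x - Real.arcsin ((1 / 2) * Real.sin (2 * π / x))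

open scoped Topology

/-- The function `δB` in the variable `t = π / x`. -/
noncomputable def angleGap (t : ℝ) : ℝ :=
  t - arcsin (sin t * cos t)

theorem δB_eq_angleGap (x : ℝ) : δB x = angleGap (π / x) := by
  rw [δB, angleGap, mul_div_assoc, sin_two_mul]
  congr 2
  ring

theorem isBigO_sin_sub_self : (fun t : ℝ => sin t - t) =O[𝓝 0] fun t => t ^ 3 := by
  refine IsBigO.of_bound 1 ?_
  filter_upwards [Metric.closedBall_mem_nhds (0 : ℝ) one_pos] with t ht
  have ht : |t| ≤ 1 := by simpa using ht
  have h := abs_le.mp (sin_bound ht)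
  have h5 : |t| ^ 5 ≤ |t| ^ 3 := pow_le_pow_of_le_one (abs_nonneg t) ht (by norm_num)
  have h3 := abs_le.mp (abs_pow t 3).le
  rw [norm_eq_abs, norm_eq_abs, abs_pow, one_mul, abs_le]
  have := pow_nonneg (abs_nonneg t) 3
  constructor <;> linarith

theorem isBigO_one_sub_cos_sub : (fun t : ℝ => 1 - cos t - t ^ 2 / 2) =O[𝓝 0] fun t => t ^ 4 := by
  refine IsBigO.of_bound (5 / 96) ?_
  filter_upwards [Metric.closedBall_mem_nhds (0 : ℝ) one_pos] with t ht
  have h := cos_bound (x := t) (by simpa using ht)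
  rw [norm_eq_abs, norm_eq_abs, abs_pow, ← abs_neg, mul_comm]
  convert h using 2
  ring

theorem continuous_angleGap : Continuous angleGap := by
  unfold angleGap
  fun_prop

theorem tendsto_angleGap : Tendsto angleGap (𝓝 0) (𝓝 0) := by
  simpa [angleGap] using continuous_angleGap.tendsto 0

theorem sin_angleGap {t : ℝ} (ht : 0 < cos t) :
    sin (angleGap t) =
      sin t ^ 3 * (√(1 - sin t ^ 2 + (sin t ^ 2) ^ 2) + (1 - sin t ^ 2))⁻¹ := by
  have hc := sin_sq_add_cos_sq t
  have hp : 0 < 1 - sin t ^ 2 := by nlinarith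
  have hq : 0 ≤ 1 - sin t ^ 2 + (sin t ^ 2) ^ 2 := by positivity
  have hr : 1 - (sin t * cos t) ^ 2 = 1 - sin t ^ 2 + (sin t ^ 2) ^ 2 := by
    rw [mul_pow, cos_sq']
    ring
  have hs : sin (arcsin (sin t * cos t)) = sin t * cos t :=
    sin_arcsin (by nlinarith [sq_nonneg (sin t + cos t)]) (by nlinarith [sq_nonneg (sin t - cos t)])
  rw [angleGap, sin_sub, cos_arcsin, hs, hr]
  have hsq := sq_sqrt hq
  rw [eq_mul_inv_iff_mul_eq₀ (by positivity)]
  linear_combination sin t * hsq - sin t * (√(1 - sin t ^ 2 + (sin t ^ 2) ^ 2) + (1 - sin t ^ 2)) * hc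

theorem isBigO_sin_angleGap_sub :
    (fun t => sin (angleGap t) - t ^ 3 / 2) =O[𝓝 0] fun t => t ^ 5 := by
  have hsin : sin =O[𝓝 0] fun t : ℝ => t := by
    simpa using (differentiableAt_sin (x := 0)).isBigO_sub
  have hy : Tendsto (fun t : ℝ => sin t ^ 2) (𝓝 0) (𝓝 0) := by
    simpa using (continuous_sin.tendsto 0).pow 2
  let q : ℝ → ℝ := fun y => (√(1 - y + y ^ 2) + (1 - y))⁻¹
  have hq : DifferentiableAt ℝ q 0 := by
    refine DifferentiableAt.inv (DifferentiableAt.add (DifferentiableAt.sqrt ?_ ?_) ?_) ?_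
    · fun_prop
    · norm_num
    · fun_prop
    · norm_num
  have hq0 : q 0 = 1 / 2 := by norm_num [q]
  have hqsub : (fun t => q (sin t ^ 2) - 1 / 2) =O[𝓝 0] fun t : ℝ => t ^ 2 := by
    have h := hq.isBigO_sub.comp_tendsto hy
    simp only [Function.comp_def, hq0, sub_zero] at h
    exact h.trans (hsin.pow 2)
  have hq1 : (fun t => q (sin t ^ 2)) =O[𝓝 0] fun _ : ℝ => (1 : ℝ) :=
    (hq.continuousAt.tendsto.comp hy).isBigO_one ℝ
  have hquad : (fun t : ℝ => sin t ^ 2 + sin t * t + t ^ 2) =O[𝓝 0] fun t => t ^ 2 :=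
    ((hsin.pow 2).add ((hsin.mul (isBigO_refl _ _)).congr_right fun t => (sq t).symm)).add
      (isBigO_refl _ _)
  have h1 := ((isBigO_sin_sub_self.mul hquad).mul hq1)
  have h2 := (isBigO_refl (fun t : ℝ => t ^ 3) (𝓝 0)).mul hqsub
  have h : (fun t : ℝ => (sin t - t) * (sin t ^ 2 + sin t * t + t ^ 2) * q (sin t ^ 2)
      + t ^ 3 * (q (sin t ^ 2) - 1 / 2)) =O[𝓝 0] fun t => t ^ 5 :=
    (h1.congr_right fun t => by ring).add (h2.congr_right fun t => by ring)
  refine h.congr' ?_ .rfl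
  filter_upwards [continuous_cos.continuousAt.eventually_const_lt (by simp : (0 : ℝ) < cos 0)]
    with t ht
  rw [sin_angleGap ht]
  simp only [q]
  ring

theorem isBigO_pow_of_le {m n : ℕ} (h : n ≤ m) :
    (fun t : ℝ => t ^ m) =O[𝓝 0] fun t => t ^ n := by
  refine IsBigO.of_bound 1 ?_
  filter_upwards [Metric.closedBall_mem_nhds (0 : ℝ) one_pos] with t ht
  rw [norm_pow, norm_pow, one_mul]
  exact pow_le_pow_of_le_one (norm_nonneg t) (by simpa using ht) h

theorem isBigO_angleGap : angleGap =O[𝓝 0] fun t => t ^ 3 := by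
  have hsin : (fun t => sin (angleGap t)) =O[𝓝 0] fun t => t ^ 3 := by
    have h := (isBigO_sin_angleGap_sub.trans (isBigO_pow_of_le (by norm_num : 3 ≤ 5))).add
      ((isBigO_refl (fun t : ℝ => t ^ 3) (𝓝 0)).const_mul_left (1 / 2))
    exact h.congr_left fun t => by ring
  have harcsin : DifferentiableAt ℝ arcsin 0 :=
    differentiableAt_arcsin.mpr (by norm_num)
  have hlim : Tendsto (fun t => sin (angleGap t)) (𝓝 0) (𝓝 0) := by
    simpa [Function.comp_def] using (continuous_sin.tendsto 0).comp tendsto_angleGap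
  have h := harcsin.isBigO_sub.comp_tendsto hlim
  simp only [Function.comp_def, arcsin_zero, sub_zero] at h
  refine (h.trans hsin).congr' ?_ .rfl
  filter_upwards [tendsto_angleGap.eventually
    (Icc_mem_nhds (neg_lt_zero.mpr pi_div_two_pos) pi_div_two_pos)] with t ht
  exact arcsin_sin ht.1 ht.2

theorem isBigO_angleGap_sub : (fun t => angleGap t - t ^ 3 / 2) =O[𝓝 0] fun t => t ^ 5 := by
  have h := (isBigO_sin_sub_self.comp_tendsto tendsto_angleGap).trans (isBigO_angleGap.pow 3)
  have h9 : (fun t : ℝ => (t ^ 3) ^ 3) =O[𝓝 0] fun t => t ^ 5 :=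
    (isBigO_pow_of_le (by norm_num : 5 ≤ 9)).congr_left fun t => by ring
  exact (isBigO_sin_angleGap_sub.sub (h.trans h9)).congr_left fun t => by
    simp only [Function.comp_apply]
    ring

theorem isBigO_one_sub_cos_angleGap_sub :
    (fun t => 1 - cos (angleGap t / 2) - t ^ 6 / 32) =O[𝓝 0] fun t => t ^ 8 := by
  have hlim : Tendsto (fun t => angleGap t / 2) (𝓝 0) (𝓝 0) := by
    simpa using tendsto_angleGap.div_const 2
  have hhalf : (fun t => angleGap t / 2) =O[𝓝 0] fun t => t ^ 3 :=
    (isBigO_angleGap.const_mul_left (1 / 2)).congr_left fun t => by ring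
  have h12 : (fun t : ℝ => (t ^ 3) ^ 4) =O[𝓝 0] fun t => t ^ 8 :=
    (isBigO_pow_of_le (by norm_num : 8 ≤ 12)).congr_left fun t => by ring
  have h1 := ((isBigO_one_sub_cos_sub.comp_tendsto hlim).trans (hhalf.pow 4)).trans h12
  have hadd := isBigO_angleGap.add
    ((isBigO_refl (fun t : ℝ => t ^ 3) (𝓝 0)).const_mul_left (1 / 2))
  have h2 := ((isBigO_angleGap_sub.mul hadd).const_mul_left (1 / 8)).congr_right
    (g₂ := fun t => t ^ 8) fun t => by ring
  exact (h1.add h2).congr_left fun t => by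
    simp only [Function.comp_apply]
    ring

theorem isBigO_sin_half_mul_one_sub_cos_angleGap_sub :
    (fun t => sin (t / 2) * (1 - cos (angleGap t / 2)) - t ^ 7 / 64)
      =O[𝓝 0] fun t => t ^ 9 := by
  have hlim : Tendsto (fun t : ℝ => t / 2) (𝓝 0) (𝓝 0) := by
    simpa using (tendsto_id (α := ℝ) (x := 𝓝 0)).div_const 2
  have hhalf : (fun t : ℝ => t / 2) =O[𝓝 0] fun t => t :=
    ((isBigO_refl (fun t : ℝ => t) (𝓝 0)).const_mul_left (1 / 2)).congr_left fun t => by ring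
  have hsin : (fun t : ℝ => sin (t / 2)) =O[𝓝 0] fun t => t := by
    refine IsBigO.trans (IsBigO.of_bound 1 (Eventually.of_forall fun t => ?_)) hhalf
    rw [one_mul]
    exact abs_sin_le_abs
  have h1 := (hsin.mul isBigO_one_sub_cos_angleGap_sub).congr_right
    (g₂ := fun t => t ^ 9) fun t => by ring
  have hsub := (isBigO_sin_sub_self.comp_tendsto hlim).trans (hhalf.pow 3)
  have h2 := ((hsub.mul (isBigO_refl (fun t : ℝ => t ^ 6) (𝓝 0))).const_mul_left
    (1 / 32)).congr_right (g₂ := fun t => t ^ 9) fun t => by ring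
  exact (h1.add h2).congr_left fun t => by
    simp only [Function.comp_apply]
    ring

theorem perimeter_gap_Bn_isBigO :
    (fun x : ℝ => 2 * x * Real.sin (π / (2 * x)) * (1 - Real.cos (δB x / 2))
        - π ^ 7 / (32 * x ^ 6))
      =O[atTop] (fun x : ℝ => 1 / x ^ 8) := by
  have hlim : Tendsto (fun x : ℝ => π / x) atTop (nhds 0) := tendsto_const_nhds.div_atTop tendsto_id
  have h := (isBigO_refl (fun x : ℝ => x) atTop).mul
    (isBigO_sin_half_mul_one_sub_cos_angleGap_sub.comp_tendsto hlim)
  have hright : (fun x : ℝ => x * (π / x) ^ 9) =O[atTop] fun x => 1 / x ^ 8 := by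
    refine ((isBigO_refl (fun x : ℝ => 1 / x ^ 8) atTop).const_mul_left (π ^ 9)).congr' ?_ .rfl
    filter_upwards [eventually_ne_atTop 0] with x hx
    field_simp
  refine ((h.trans hright).const_mul_left 2).congr' ?_ .rfl
  filter_upwards [eventually_ne_atTop 0] with x hx
  have hdiv : π / x / 2 = π / (2 * x) := by rw [div_div, mul_comm]
  simp only [Function.comp_apply, δB_eq_angleGap, hdiv]
  field_simp
  ring
end

section
/- As the real variable x tends to infinity, cos(π/(2x)) − cos(π/x) − 3π²/(8x²) = O(1/x⁴); that is, the gap between the width upper bound cos(π/(2x)) and the width cos(π/x) of the regular small x-gon (x even) equals 3π²/(8x²) + O(1/x⁴). -/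
open Real Filter Asymptotics

theorem cos_sub_one_sub_sq_div_two_isBigO :
    (fun y : ℝ => Real.cos y - (1 - y ^ 2 / 2)) =O[nhds 0] (fun y : ℝ => y ^ 4) := by
  refine IsBigO.of_bound (5 / 96) ?_
  filter_upwards [Metric.closedBall_mem_nhds (0 : ℝ) one_pos] with y hy
  have h := Real.cos_bound (x := y) (by simpa using hy)
  rw [Real.norm_eq_abs, norm_pow, Real.norm_eq_abs]
  linarith

theorem cos_const_div_sub_isBigO (c : ℝ) :
    (fun x : ℝ => Real.cos (c / x) - (1 - (c / x) ^ 2 / 2))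
      =O[atTop] (fun x : ℝ => 1 / x ^ 4) := by
  refine (cos_sub_one_sub_sq_div_two_isBigO.comp_tendsto
    (tendsto_const_nhds.div_atTop tendsto_id : Tendsto (fun x : ℝ => c / x) atTop _)).trans ?_
  refine (isBigO_const_mul_self (c ^ 4) (fun x : ℝ => 1 / x ^ 4) atTop).congr_left fun x => ?_
  simp only [Function.comp_apply]
  ring

theorem width_gap_Rn_isBigO :
    (fun x : ℝ => Real.cos (π / (2 * x)) - Real.cos (π / x) - 3 * π ^ 2 / (8 * x ^ 2))
      =O[atTop] (fun x : ℝ => 1 / x ^ 4) := by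
  refine ((cos_const_div_sub_isBigO (π / 2)).sub (cos_const_div_sub_isBigO π)).congr_left
    fun x => ?_
  rw [div_div]
  ring
end
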